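/- arXiv:1209.4438 — 2 statements merged into one kernel-verified Lean document; each statement's English description precedes it below -/
import Mathlib

section
/- There exists a 4-sparse 4-cycle system of order v if and only if v ≡ 1 (mod 8). -/
open Finset

/-- The edge set of the 4-cycle `(a, b, c, d)`: edges {a,b}, {b,c}, {c,d}, {d,a}. -/
def cycEdges {V : Type*} [DecidableEq V] (a b c d : V) : Finset (Sym2 V) :=
  {s(a, b), s(b, c), s(c, d), s(d, a)}

/-- `E` is the edge set of a 4-cycle on four distinct vertices. -/
def IsFourCycle {V : Type*} [DecidableEq V] (E : Finset (Sym2 V)) : Prop :=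
  ∃ a b c d : V, ([a, b, c, d] : List V).Nodup ∧ E = cycEdges a b c d

/-- The set of vertices covered by a set of edges. -/
def edgeVerts {V : Type*} [DecidableEq V] (E : Finset (Sym2 V)) : Finset V :=
  E.sup (Sym2.lift ⟨fun x y => ({x, y} : Finset V), fun x y => Finset.pair_comm x y⟩)

/-- A `(k, l)`-configuration: a set of `l` pairwise edge-disjoint 4-cycles whose
union contains exactly `k` vertices. -/
def IsConfiguration {V : Type*} [DecidableEq V] (k l : ℕ)
    (D : Finset (Finset (Sym2 V))) : Prop :=
  D.card = l ∧ (∀ E ∈ D, IsFourCycle E) ∧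
    (∀ E ∈ D, ∀ F ∈ D, E ≠ F → Disjoint E F) ∧
    (D.sup edgeVerts).card = k

/-- `C` is a 4-cycle system: a collection of 4-cycles whose edge sets partition
the edge set of the complete graph on `V`. -/
def IsFourCycleSystem {V : Type*} [DecidableEq V] (C : Finset (Finset (Sym2 V))) : Prop :=
  (∀ E ∈ C, IsFourCycle E) ∧ ∀ e : Sym2 V, ¬ e.IsDiag → ∃! E, E ∈ C ∧ e ∈ E

/-- `C` is a 4-cycle packing: a set of pairwise edge-disjoint 4-cycles. -/
def IsFourCyclePacking {V : Type*} [DecidableEq V] (C : Finset (Finset (Sym2 V))) : Prop :=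
  (∀ E ∈ C, IsFourCycle E) ∧ ∀ E ∈ C, ∀ F ∈ C, E ≠ F → Disjoint E F

/-- `C` is `r`-sparse: it contains no `(j+3, j)`-configuration for `2 ≤ j ≤ r`. -/
def RSparse {V : Type*} [DecidableEq V] (r : ℕ) (C : Finset (Finset (Sym2 V))) : Prop :=
  ∀ j, 2 ≤ j → j ≤ r → ∀ D ⊆ C, ¬ IsConfiguration (j + 3) j D

/-- Two 4-cycles form a double-diamond: they are `(a,b,c,d)` and `(a,e,c,f)`,
sharing the diagonal {a,c}. -/
def IsDoubleDiamond {V : Type*} [DecidableEq V] (E F : Finset (Sym2 V)) : Prop :=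
  ∃ a b c d e f : V, ([a, b, c, d, e, f] : List V).Nodup ∧
    E = cycEdges a b c d ∧ F = cycEdges a e c f

/-- `C` is D-avoiding: no two of its 4-cycles form a double-diamond. -/
def DAvoiding {V : Type*} [DecidableEq V] (C : Finset (Finset (Sym2 V))) : Prop :=
  ∀ E ∈ C, ∀ F ∈ C, ¬ IsDoubleDiamond E F

/-- `C` is strictly `r`-sparse: `r`-sparse and D-avoiding. -/
def StrictlyRSparse {V : Type*} [DecidableEq V] (r : ℕ)
    (C : Finset (Finset (Sym2 V))) : Prop :=
  RSparse r C ∧ DAvoiding C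

set_option linter.unusedSectionVars false
set_option linter.unusedSimpArgs false
set_option linter.flexible false

section General

variable {V : Type*} [DecidableEq V]

lemma edgeVerts_cyc (a b c d : V) : edgeVerts (cycEdges a b c d) = {a, b, c, d} := by
  ext x
  simp [edgeVerts, cycEdges]
  tauto

lemma fc_card {E : Finset (Sym2 V)} (hE : IsFourCycle E) : (edgeVerts E).card = 4 := by
  obtain ⟨a, b, c, d, hn, rfl⟩ := hE
  rw [edgeVerts_cyc]
  simp at hn
  grind

lemma fc_edge {E : Finset (Sym2 V)} (hE : IsFourCycle E) {x y : V} (h : s(x, y) ∈ E) :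
    x ∈ edgeVerts E ∧ y ∈ edgeVerts E ∧ x ≠ y := by
  obtain ⟨a, b, c, d, hn, rfl⟩ := hE
  rw [edgeVerts_cyc]
  simp at hn
  simp [cycEdges] at h ⊢
  grind

lemma fc_nbr {E : Finset (Sym2 V)} (hE : IsFourCycle E) {x : V} (h : x ∈ edgeVerts E) :
    ∃ y z, y ≠ z ∧ s(x, y) ∈ E ∧ s(x, z) ∈ E := by
  obtain ⟨a, b, c, d, hn, rfl⟩ := hE
  rw [edgeVerts_cyc] at h
  simp at hn h
  rcases h with rfl | rfl | rfl | rfl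
  · exact ⟨b, d, by grind, by simp [cycEdges], by simp [cycEdges]⟩
  · exact ⟨a, c, by grind, by simp [cycEdges], by simp [cycEdges]⟩
  · exact ⟨b, d, by grind, by simp [cycEdges], by simp [cycEdges]⟩
  · exact ⟨a, c, by grind, by simp [cycEdges], by simp [cycEdges]⟩

lemma fc_three {E : Finset (Sym2 V)} (hE : IsFourCycle E) {x y z : V}
    (hx : x ∈ edgeVerts E) (hy : y ∈ edgeVerts E) (hz : z ∈ edgeVerts E)
    (hxy : x ≠ y) (hyz : y ≠ z) (hxz : x ≠ z) : s(x, y) ∈ E ∨ s(y, z) ∈ E := by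
  obtain ⟨a, b, c, d, hn, rfl⟩ := hE
  rw [edgeVerts_cyc] at hx hy hz
  simp at hn hx hy hz
  simp only [cycEdges, Finset.mem_insert, Finset.mem_singleton, Sym2.eq_iff]
  grind

/-- Opposite pairs in a 4-cycle. -/
lemma cyc_pairs {a b c d x y u w : V}
    (hx : x ∈ edgeVerts (cycEdges a b c d)) (hy : y ∈ edgeVerts (cycEdges a b c d))
    (hu : u ∈ edgeVerts (cycEdges a b c d)) (hw : w ∈ edgeVerts (cycEdges a b c d))
    (hn : [x, y, u, w].Nodup) :
    ((s(x, y) = s(a, c) ∧ s(u, w) = s(b, d)) ∨ (s(x, y) = s(b, d) ∧ s(u, w) = s(a, c))) ∨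
    ((s(x, y) = s(a, b) ∧ s(u, w) = s(c, d)) ∨ (s(x, y) = s(c, d) ∧ s(u, w) = s(a, b))) ∨
    ((s(x, y) = s(b, c) ∧ s(u, w) = s(d, a)) ∨ (s(x, y) = s(d, a) ∧ s(u, w) = s(b, c))) := by
  rw [edgeVerts_cyc] at hx hy hu hw
  simp at hn hx hy hu hw
  simp only [Sym2.eq_iff]
  grind

lemma fc_opp {E : Finset (Sym2 V)} (hE : IsFourCycle E) {x y u w : V}
    (hx : x ∈ edgeVerts E) (hy : y ∈ edgeVerts E) (hu : u ∈ edgeVerts E) (hw : w ∈ edgeVerts E)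
    (hn : [x, y, u, w].Nodup) (h : s(x, y) ∈ E) : s(u, w) ∈ E := by
  obtain ⟨a, b, c, d, hn', rfl⟩ := hE
  simp at hn'
  rcases cyc_pairs hx hy hu hw hn with (⟨h1, h2⟩ | ⟨h1, h2⟩) | (⟨h1, h2⟩ | ⟨h1, h2⟩) | ⟨h1, h2⟩ | ⟨h1, h2⟩
  · rw [h1] at h
    simp [cycEdges] at h
    grind
  · rw [h1] at h
    simp [cycEdges] at h
    grind
  all_goals
    rw [h2]
    simp [cycEdges]

lemma fc_inter {E F : Finset (Sym2 V)} (hE : IsFourCycle E) (hF : IsFourCycle F)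
    (hd : Disjoint E F) : (edgeVerts E ∩ edgeVerts F).card ≤ 2 := by
  by_contra! h
  obtain ⟨p, hp, q, hq, r, hr, h1, h2, h3⟩ := Finset.two_lt_card.1 h
  rw [Finset.mem_inter] at hp hq hr
  have e1 := fc_three hE hp.1 hq.1 hr.1 h1 h3 h2
  have e2 := fc_three hE hq.1 hr.1 hp.1 h3 h2.symm h1.symm
  have e3 := fc_three hE hr.1 hp.1 hq.1 h2.symm h1 h3.symm
  have f1 := fc_three hF hp.2 hq.2 hr.2 h1 h3 h2
  have f2 := fc_three hF hq.2 hr.2 hp.2 h3 h2.symm h1.symm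
  have f3 := fc_three hF hr.2 hp.2 hq.2 h2.symm h1 h3.symm
  have d1 : s(p, q) ∈ E → s(p, q) ∉ F := fun h => Finset.disjoint_left.1 hd h
  have d2 : s(q, r) ∈ E → s(q, r) ∉ F := fun h => Finset.disjoint_left.1 hd h
  have d3 : s(r, p) ∈ E → s(r, p) ∉ F := fun h => Finset.disjoint_left.1 hd h
  tauto

/-- Three edge-disjoint cycles through `x` on at most seven vertices use all edges at `x`. -/
lemma fc_sat {A B C : Finset (Sym2 V)} (hA : IsFourCycle A) (hB : IsFourCycle B)
    (hC : IsFourCycle C) (hAB : Disjoint A B) (hAC : Disjoint A C) (hBC : Disjoint B C)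
    {U : Finset V} (hU : U.card = 7) (uA : edgeVerts A ⊆ U) (uB : edgeVerts B ⊆ U)
    (uC : edgeVerts C ⊆ U) {x : V} (xA : x ∈ edgeVerts A) (xB : x ∈ edgeVerts B)
    (xC : x ∈ edgeVerts C) {u : V} (hu : u ∈ U) (hux : u ≠ x) :
    s(x, u) ∈ A ∨ s(x, u) ∈ B ∨ s(x, u) ∈ C := by
  obtain ⟨a, a', ha, ha1, ha2⟩ := fc_nbr hA xA
  obtain ⟨b, b', hb, hb1, hb2⟩ := fc_nbr hB xB
  obtain ⟨c, c', hc, hc1, hc2⟩ := fc_nbr hC xC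
  have key : ∀ {P Q : Finset (Sym2 V)}, Disjoint P Q → ∀ {y z : V}, s(x, y) ∈ P → s(x, z) ∈ Q →
      y ≠ z := by
    rintro P Q h y z hy hz rfl
    exact Finset.disjoint_left.1 h hy hz
  have k1 := key hAB ha1 hb1
  have k2 := key hAB ha1 hb2
  have k3 := key hAB ha2 hb1
  have k4 := key hAB ha2 hb2
  have k5 := key hAC ha1 hc1
  have k6 := key hAC ha1 hc2
  have k7 := key hAC ha2 hc1
  have k8 := key hAC ha2 hc2
  have k9 := key hBC hb1 hc1
  have k10 := key hBC hb1 hc2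
  have k11 := key hBC hb2 hc1
  have k12 := key hBC hb2 hc2
  have hcard : ({a, a', b, b', c, c'} : Finset V).card = 6 := by
    simp [*]
  have hsub : ({a, a', b, b', c, c'} : Finset V) ⊆ U.erase x := by
    intro y hy
    simp only [Finset.mem_insert, Finset.mem_singleton] at hy
    rw [Finset.mem_erase]
    rcases hy with rfl | rfl | rfl | rfl | rfl | rfl
    · have := fc_edge hA ha1; exact ⟨this.2.2.symm, uA this.2.1⟩
    · have := fc_edge hA ha2; exact ⟨this.2.2.symm, uA this.2.1⟩
    · have := fc_edge hB hb1; exact ⟨this.2.2.symm, uB this.2.1⟩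
    · have := fc_edge hB hb2; exact ⟨this.2.2.symm, uB this.2.1⟩
    · have := fc_edge hC hc1; exact ⟨this.2.2.symm, uC this.2.1⟩
    · have := fc_edge hC hc2; exact ⟨this.2.2.symm, uC this.2.1⟩
  have heq := Finset.eq_of_subset_of_card_le hsub (by
    rw [hcard, Finset.card_erase_of_mem (uA xA), hU])
  have hu' : u ∈ ({a, a', b, b', c, c'} : Finset V) := by
    rw [heq]; exact Finset.mem_erase.2 ⟨hux, hu⟩
  simp only [Finset.mem_insert, Finset.mem_singleton] at hu'
  rcases hu' with rfl | rfl | rfl | rfl | rfl | rfl <;> tauto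

/-! ### Necessity -/

lemma fc_edgecard {E : Finset (Sym2 V)} (hE : IsFourCycle E) : E.card = 4 := by
  obtain ⟨a, b, c, d, hn, rfl⟩ := hE
  simp at hn
  obtain ⟨⟨h1, h2, h3⟩, ⟨h4, h5⟩, h6⟩ := hn
  unfold cycEdges
  rw [Finset.card_insert_of_notMem, Finset.card_insert_of_notMem, Finset.card_insert_of_notMem,
    Finset.card_singleton]
  all_goals simp only [Finset.mem_insert, Finset.mem_singleton, Sym2.eq_iff]
  all_goals grind

lemma fc_deg {E : Finset (Sym2 V)} (hE : IsFourCycle E) (x : V) :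
    Even (E.filter (fun e => x ∈ e)).card := by
  obtain ⟨a, b, c, d, hn, rfl⟩ := hE
  simp at hn
  obtain ⟨⟨h1, h2, h3⟩, ⟨h4, h5⟩, h6⟩ := hn
  have e1 : s(a, b) ≠ s(b, c) := by simp only [ne_eq, Sym2.eq_iff]; grind
  have e2 : s(b, c) ≠ s(c, d) := by simp only [ne_eq, Sym2.eq_iff]; grind
  have e3 : s(c, d) ≠ s(d, a) := by simp only [ne_eq, Sym2.eq_iff]; grind
  have e4 : s(a, b) ≠ s(d, a) := by simp only [ne_eq, Sym2.eq_iff]; grind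
  unfold cycEdges
  simp only [Finset.filter_insert, Finset.filter_singleton, Sym2.mem_iff]
  by_cases xa : x = a
  · subst xa
    simp [h1, h2, h3, h4, h5, h6, e1, e2, e3, e4, Ne.symm e4]
  by_cases xb : x = b
  · subst xb
    simp [h1, h2, h3, h4, h5, h6, Ne.symm h1, e1, e2, e3, e4]
  by_cases xc : x = c
  · subst xc
    simp [h1, h2, h3, h4, h5, h6, Ne.symm h2, Ne.symm h4, e1, e2, e3, e4]
  by_cases xd : x = d
  · subst xd
    simp [h1, h2, h3, h4, h5, h6, Ne.symm h3, Ne.symm h5, Ne.symm h6, e1, e2, e3, e4]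
  simp [xa, xb, xc, xd]

lemma sys_sum [Fintype V] {C : Finset (Finset (Sym2 V))} (hC : IsFourCycleSystem C)
    (p : Sym2 V → Prop) [DecidablePred p] :
    ∑ E ∈ C, (E.filter p).card = (Finset.univ.filter (fun e : Sym2 V => ¬ e.IsDiag ∧ p e)).card := by
  rw [← Finset.card_biUnion]
  · congr 1
    ext e
    simp only [Finset.mem_biUnion, Finset.mem_filter, Finset.mem_univ, true_and]
    constructor
    · rintro ⟨E, hE, he, hp⟩
      refine ⟨?_, hp⟩
      induction e with
      | _ x y => exact (fc_edge (hC.1 E hE) he).2.2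
    · rintro ⟨hd, hp⟩
      obtain ⟨E, ⟨hE, he⟩, -⟩ := hC.2 e hd
      exact ⟨E, hE, he, hp⟩
  · intro E hE F hF hne
    rw [Function.onFun, Finset.disjoint_left]
    intro e he hf
    simp only [Finset.mem_filter] at he hf
    apply hne
    have hd : ¬ e.IsDiag := by
      have := he.1
      clear hf he
      induction e with
      | _ x y => exact (fc_edge (hC.1 E hE) this).2.2
    exact (hC.2 e hd).unique ⟨hE, he.1⟩ ⟨hF, hf.1⟩

end General

lemma necessity (v : ℕ) (hv : 0 < v) {C : Finset (Finset (Sym2 (Fin v)))}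
    (hC : IsFourCycleSystem C) : v % 8 = 1 := by
  have h1 := sys_sum hC (fun _ => True)
  have h2 := sys_sum hC (fun e => (⟨0, hv⟩ : Fin v) ∈ e)
  have h3 : ∑ E ∈ C, (E.filter (fun _ => True)).card = 4 * C.card := by
    rw [Finset.sum_congr rfl (g := fun _ => 4), Finset.sum_const, smul_eq_mul, mul_comm]
    intro E hE
    simp [fc_edgecard (hC.1 E hE)]
  have h4 : Even (∑ E ∈ C, (E.filter (fun e => (⟨0, hv⟩ : Fin v) ∈ e)).card) :=
    Finset.even_sum _ fun E hE => fc_deg (hC.1 E hE) _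
  have h5 : (Finset.univ.filter (fun e : Sym2 (Fin v) => ¬ e.IsDiag ∧ True)).card = v.choose 2 := by
    simp only [and_true]
    rw [← Fintype.card_subtype, Sym2.card_subtype_not_diag, Fintype.card_fin]
  have h6 : (Finset.univ.filter
      (fun e : Sym2 (Fin v) => ¬ e.IsDiag ∧ (⟨0, hv⟩ : Fin v) ∈ e)).card = v - 1 := by
    have : (Finset.univ.filter (fun e : Sym2 (Fin v) => ¬ e.IsDiag ∧ (⟨0, hv⟩ : Fin v) ∈ e))
        = (Finset.univ.erase (⟨0, hv⟩ : Fin v)).image (fun y => s(⟨0, hv⟩, y)) := by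
      ext e
      simp only [Finset.mem_filter, Finset.mem_univ, true_and, Finset.mem_image,
        Finset.mem_erase, and_true]
      constructor
      · rintro ⟨hd, y, rfl⟩
        exact ⟨y, fun h => hd h.symm, rfl⟩
      · rintro ⟨y, hy, rfl⟩
        exact ⟨fun h => hy h.symm, Sym2.mem_mk_left _ _⟩
    rw [this, Finset.card_image_of_injective, Finset.card_erase_of_mem (Finset.mem_univ _),
      Finset.card_univ, Fintype.card_fin]
    intro y z h
    simp only [Sym2.eq_iff] at h
    grind
  rw [h6] at h2
  rw [h2] at h4
  rw [h3, h5] at h1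
  rw [Nat.choose_two_right] at h1
  have h7 : v * (v - 1) % 2 = 0 := Nat.even_iff.1 (Nat.even_mul_pred_self v)
  obtain ⟨k, hk⟩ := h4
  have hv' : v = 2 * k + 1 := by omega
  subst hv'
  have h8 : (2 * k + 1) * (2 * k + 1 - 1) = 8 * C.card := by omega
  have h9 : k * (2 * k + 1) = 4 * C.card := by
    have : (2 * k + 1) * (2 * k) = 8 * C.card := by simpa using h8
    nlinarith
  have h10 : k % 4 = 0 := by
    have h11 : 4 ∣ k * (2 * k + 1) := ⟨_, h9⟩
    have h12 : Nat.Coprime 4 (2 * k + 1) := by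
      have : Nat.Coprime (2 ^ 2) (2 * k + 1) := by
        apply Nat.Coprime.pow_left
        simp
      simpa using this
    exact Nat.mod_eq_zero_of_dvd (h12.dvd_of_dvd_mul_right h11)
  omega

/-! ### The construction -/

section Construction

variable {V : Type*} [DecidableEq V] [CommRing V]

/-- The base cycle number `i` translated by `t`. -/
def cyc (i : ℕ) (t : V) : Finset (Sym2 V) :=
  cycEdges t (t + (4 * i + 1)) (t - 2) (t + (4 * i + 2))

/-- Membership in the constructed system. -/
def InC (n : ℕ) (E : Finset (Sym2 V)) : Prop := ∃ i < n, ∃ t : V, E = cyc i t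

/-- small multiples of one do not vanish -/
def Good (V : Type*) [CommRing V] (n : ℕ) : Prop :=
  ∀ k : ℕ, 0 < k → k < 8 * n + 1 → (k : V) ≠ 0

lemma InC.fc {n : ℕ} (hz : Good V n) {E : Finset (Sym2 V)} (h : InC n E) : IsFourCycle E := by
  obtain ⟨i, hi, t, rfl⟩ := h
  refine ⟨_, _, _, _, ?_, rfl⟩
  simp only [List.nodup_cons, List.mem_cons, List.not_mem_nil, or_false, not_or,
    List.nodup_nil, not_false_eq_true, and_true]
  refine ⟨⟨?_, ?_, ?_⟩, ⟨?_, ?_⟩, ?_⟩ <;> intro h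
  · exact hz (4 * i + 1) (by omega) (by omega) (by push_cast; linear_combination -h)
  · exact hz 2 (by omega) (by omega) (by push_cast; linear_combination h)
  · exact hz (4 * i + 2) (by omega) (by omega) (by push_cast; linear_combination -h)
  · exact hz (4 * i + 3) (by omega) (by omega) (by push_cast; linear_combination h)
  · exact hz 1 (by omega) (by omega) (by push_cast; linear_combination -h)
  · exact hz (4 * i + 4) (by omega) (by omega) (by push_cast; linear_combination -h)

lemma pair_inj {n : ℕ} (hz : Good V n) {k m : ℕ} (hk : 0 < k) (hk' : k ≤ 4 * n) (hm : 0 < m)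
    (hm' : m ≤ 4 * n) {u t : V} (h : s(u, u + (k : V)) = s(t, t + (m : V))) : k = m ∧ u = t := by
  rw [Sym2.eq_iff] at h
  rcases h with ⟨h1, h2⟩ | ⟨h1, h2⟩
  · refine ⟨?_, h1⟩
    rcases lt_trichotomy k m with h | h | h
    · exact absurd (by rw [Nat.cast_sub h.le]; linear_combination h1 - h2)
        (hz (m - k) (by omega) (by omega))
    · exact h
    · exact absurd (by rw [Nat.cast_sub h.le]; linear_combination h2 - h1)
        (hz (k - m) (by omega) (by omega))
  · exact absurd (by push_cast; linear_combination h2 - h1)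
      (hz (k + m) (by omega) (by omega))

lemma mem_cyc {i : ℕ} {t : V} {e : Sym2 V} : e ∈ cyc i t ↔
    (e = s(t, t + ((4 * i + 1 : ℕ) : V)) ∨ e = s(t, t + ((4 * i + 2 : ℕ) : V))) ∨
    (e = s(t - 2, t - 2 + ((4 * i + 3 : ℕ) : V)) ∨
      e = s(t - 2, t - 2 + ((4 * i + 4 : ℕ) : V))) := by
  have h1 : t - 2 + ((4 * i + 3 : ℕ) : V) = t + (4 * i + 1) := by push_cast; ring
  have h2 : t - 2 + ((4 * i + 4 : ℕ) : V) = t + (4 * i + 2) := by push_cast; ring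
  rw [h1, h2]
  simp only [cyc, cycEdges, Finset.mem_insert, Finset.mem_singleton]
  rw [Sym2.eq_swap (a := t + (4 * (i : V) + 1)), Sym2.eq_swap (a := t + (4 * (i : V) + 2)) (b := t)]
  push_cast
  tauto

lemma mem_cyc_iff {n : ℕ} (hz : Good V n) {i : ℕ} (hi : i < n) {t u : V} {k : ℕ}
    (hk : 0 < k) (hk' : k ≤ 4 * n) :
    s(u, u + (k : V)) ∈ cyc i t ↔
    ((k = 4 * i + 1 ∧ u = t) ∨ (k = 4 * i + 2 ∧ u = t)) ∨
    ((k = 4 * i + 3 ∧ u = t - 2) ∨ (k = 4 * i + 4 ∧ u = t - 2)) := by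
  rw [mem_cyc]
  have key : ∀ (m : ℕ) (w : V), 0 < m → m ≤ 4 * n →
      (s(u, u + (k : V)) = s(w, w + (m : V)) ↔ (k = m ∧ u = w)) := by
    intro m w h1 h2
    refine ⟨pair_inj hz hk hk' h1 h2, ?_⟩
    rintro ⟨rfl, rfl⟩; rfl
  rw [key _ _ (by omega) (by omega), key _ _ (by omega) (by omega), key _ _ (by omega) (by omega),
    key _ _ (by omega) (by omega)]

lemma InC.uniq {n : ℕ} (hz : Good V n) {E F : Finset (Sym2 V)} (hE : InC n E) (hF : InC n F)
    {e : Sym2 V} (h1 : e ∈ E) (h2 : e ∈ F) : E = F := by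
  obtain ⟨i, hi, t, rfl⟩ := hE
  obtain ⟨j, hj, r, rfl⟩ := hF
  rcases mem_cyc.1 h1 with (rfl | rfl) | (rfl | rfl) <;>
  · rw [mem_cyc_iff hz hj (by omega) (by omega)] at h2
    rcases h2 with (⟨h3, h4⟩ | ⟨h3, h4⟩) | (⟨h3, h4⟩ | ⟨h3, h4⟩) <;>
    first
    | omega
    | (obtain rfl : i = j := by omega
       obtain rfl : t = r := by linear_combination h4
       rfl)

lemma InC.disj {n : ℕ} (hz : Good V n) {E F : Finset (Sym2 V)} (hE : InC n E) (hF : InC n F)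
    (hne : E ≠ F) : Disjoint E F := by
  rw [Finset.disjoint_left]
  exact fun e h1 h2 => hne (hE.uniq hz hF h1 h2)

lemma InC.ex {n : ℕ} (hs : ∀ x : V, ∃ k < 8 * n + 1, x = (k : V))
    (h0 : ((8 * n + 1 : ℕ) : V) = 0)
    {x y : V} (hxy : x ≠ y) : ∃ E : Finset (Sym2 V), InC n E ∧ s(x, y) ∈ E := by
  have main : ∀ (u : V) (k : ℕ), 0 < k → k ≤ 4 * n →
      ∃ E : Finset (Sym2 V), InC n E ∧ s(u, u + (k : V)) ∈ E := by
    intro u k h1 h2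
    obtain ⟨i, hi⟩ : ∃ i, k = 4 * i + 1 ∨ k = 4 * i + 2 ∨ k = 4 * i + 3 ∨ k = 4 * i + 4 :=
      ⟨(k - 1) / 4, by omega⟩
    rcases hi with rfl | rfl | rfl | rfl
    · exact ⟨cyc i u, ⟨i, by omega, u, rfl⟩, by rw [mem_cyc]; simp⟩
    · exact ⟨cyc i u, ⟨i, by omega, u, rfl⟩, by rw [mem_cyc]; simp⟩
    · exact ⟨cyc i (u + 2), ⟨i, by omega, u + 2, rfl⟩, by rw [mem_cyc]; simp⟩
    · exact ⟨cyc i (u + 2), ⟨i, by omega, u + 2, rfl⟩, by rw [mem_cyc]; simp⟩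
  obtain ⟨k, hk, h⟩ := hs (y - x)
  have hk0 : k ≠ 0 := by
    rintro rfl
    apply hxy
    push_cast at h
    linear_combination -h
  by_cases hk4 : k ≤ 4 * n
  · obtain ⟨E, hE, he⟩ := main x k (by omega) hk4
    refine ⟨E, hE, ?_⟩
    rwa [← h, add_sub_cancel] at he
  · obtain ⟨E, hE, he⟩ := main y (8 * n + 1 - k) (by omega) (by omega)
    refine ⟨E, hE, ?_⟩
    rw [Nat.cast_sub hk.le, h0, ← h] at he
    rw [Sym2.eq_swap]
    convert he using 2
    ring_nf

/-- length one -/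
def L1 (x y : V) : Prop := x - y = 1 ∨ y - x = 1
/-- length two -/
def L2 (x y : V) : Prop := x - y = 2 ∨ y - x = 2

lemma InC.diag {n : ℕ} {E : Finset (Sym2 V)} (hE : InC n E) {x y u w : V}
    (hx : x ∈ edgeVerts E) (hy : y ∈ edgeVerts E) (hu : u ∈ edgeVerts E) (hw : w ∈ edgeVerts E)
    (hn : [x, y, u, w].Nodup) (h : s(x, y) ∉ E) : (L1 x y ∧ L2 u w) ∨ (L2 x y ∧ L1 u w) := by
  obtain ⟨i, hi, t, rfl⟩ := hE
  rcases cyc_pairs hx hy hu hw hn with (⟨h1, h2⟩ | ⟨h1, h2⟩) | (⟨h1, h2⟩ | ⟨h1, h2⟩) | ⟨h1, h2⟩ | ⟨h1, h2⟩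
  · right
    rw [Sym2.eq_iff] at h1 h2
    unfold L1 L2
    constructor
    · rcases h1 with ⟨rfl, rfl⟩ | ⟨rfl, rfl⟩ <;> ring_nf <;> simp
    · rcases h2 with ⟨rfl, rfl⟩ | ⟨rfl, rfl⟩ <;> ring_nf <;> simp
  · left
    rw [Sym2.eq_iff] at h1 h2
    unfold L1 L2
    constructor
    · rcases h1 with ⟨rfl, rfl⟩ | ⟨rfl, rfl⟩ <;> ring_nf <;> simp
    · rcases h2 with ⟨rfl, rfl⟩ | ⟨rfl, rfl⟩ <;> ring_nf <;> simp
  all_goals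
    exfalso
    apply h
    rw [h1]
    simp [cyc, cycEdges]

/-- Opposite pairs have different lengths. -/
lemma InC.opp {n : ℕ} (hz : Good V n) {E : Finset (Sym2 V)} (hE : InC n E) {x y u w : V}
    (hx : x ∈ edgeVerts E) (hy : y ∈ edgeVerts E) (hu : u ∈ edgeVerts E) (hw : w ∈ edgeVerts E)
    (hn : [x, y, u, w].Nodup) (h : x - y = u - w ∨ x - y = w - u) : False := by
  obtain ⟨i, hi, t, rfl⟩ := hE
  have z1 : (1 : V) ≠ 0 := by simpa using hz 1 (by omega) (by omega)
  have z3 : (3 : V) ≠ 0 := by simpa using hz 3 (by omega) (by omega)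
  have z5 : (8 * (i : V) + 5) ≠ 0 := by simpa using hz (8 * i + 5) (by omega) (by omega)
  have hp := cyc_pairs hx hy hu hw hn
  simp only [Sym2.eq_iff] at hp
  rcases hp with (⟨h1, h2⟩ | ⟨h1, h2⟩) | (⟨h1, h2⟩ | ⟨h1, h2⟩) | ⟨h1, h2⟩ | ⟨h1, h2⟩ <;>
  clear hx hy hu hw hn <;>
  rcases h1 with ⟨rfl, rfl⟩ | ⟨rfl, rfl⟩ <;>
  rcases h2 with ⟨rfl, rfl⟩ | ⟨rfl, rfl⟩ <;>
  rcases h with h | h <;>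
  first
  | exact z1 (by linear_combination h)
  | exact z1 (by linear_combination -h)
  | exact z3 (by linear_combination h)
  | exact z3 (by linear_combination -h)
  | exact z5 (by linear_combination h)
  | exact z5 (by linear_combination -h)

lemma InC.pos {n : ℕ} {E : Finset (Sym2 V)} (hE : InC n E) : 0 < n := by
  obtain ⟨i, hi, -⟩ := hE
  omega

lemma L12 {n : ℕ} (hz : Good V n) (hn : 0 < n) {x y : V} (h1 : L1 x y) (h2 : L2 x y) : False := by
  have z1 : (1 : V) ≠ 0 := by simpa using hz 1 (by omega) (by omega)
  have z3 : (3 : V) ≠ 0 := by simpa using hz 3 (by omega) (by omega)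
  unfold L1 at h1
  unfold L2 at h2
  rcases h1 with h1 | h1 <;> rcases h2 with h2 | h2
  · exact z1 (by linear_combination h1 - h2)
  · exact z3 (by linear_combination -h2 - h1)
  · exact z3 (by linear_combination -h2 - h1)
  · exact z1 (by linear_combination h1 - h2)

/-- Two diagonal cycles and a third one cannot form a (6,3)-configuration. -/
lemma six_aux {n : ℕ} (hz : Good V n) {A B C : Finset (Sym2 V)} (hA : InC n A) (hB : InC n B)
    (hC : InC n C) {p p' q q' r r' : V}
    (nA : [q, q', r, r'].Nodup) (nB : [p, p', r, r'].Nodup) (nC : [p, p', q, q'].Nodup)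
    (qA : q ∈ edgeVerts A) (qA' : q' ∈ edgeVerts A) (rA : r ∈ edgeVerts A) (rA' : r' ∈ edgeVerts A)
    (pB : p ∈ edgeVerts B) (pB' : p' ∈ edgeVerts B) (rB : r ∈ edgeVerts B) (rB' : r' ∈ edgeVerts B)
    (pC : p ∈ edgeVerts C) (pC' : p' ∈ edgeVerts C) (qC : q ∈ edgeVerts C) (qC' : q' ∈ edgeVerts C)
    (hb : s(p, p') ∉ B) (hc : s(p, p') ∉ C) : False := by
  have h1 := hB.diag pB pB' rB rB' nB hb
  have h2 := hC.diag pC pC' qC qC' nC hc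
  have h3 := hA.opp hz qA qA' rA rA' nA
  have h4 : L1 p p' → L2 p p' → False := L12 hz hA.pos
  have h5 : (L1 q q' ∧ L1 r r') ∨ (L2 q q' ∧ L2 r r') := by tauto
  apply h3
  unfold L1 L2 at h5
  rcases h5 with ⟨h | h, h' | h'⟩ | ⟨h | h, h' | h'⟩
  · left; linear_combination h - h'
  · right; linear_combination h - h'
  · right; linear_combination h' - h
  · left; linear_combination h' - h
  · left; linear_combination h - h'
  · right; linear_combination h - h'
  · right; linear_combination h' - h
  · left; linear_combination h' - h

set_option maxHeartbeats 1000000 in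
lemma no_six {n : ℕ} (hz : Good V n) {A B C : Finset (Sym2 V)} (hA : InC n A) (hB : InC n B)
    (hC : InC n C) (hAB : A ≠ B) (hAC : A ≠ C) (hBC : B ≠ C) :
    7 ≤ (edgeVerts A ∪ edgeVerts B ∪ edgeVerts C).card := by
  by_contra! hU
  have cA := fc_card (hA.fc hz)
  have cB := fc_card (hB.fc hz)
  have cC := fc_card (hC.fc hz)
  have dAB := hA.disj hz hB hAB
  have dAC := hA.disj hz hC hAC
  have dBC := hB.disj hz hC hBC
  have iAB := fc_inter (hA.fc hz) (hB.fc hz) dAB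
  have iAC := fc_inter (hA.fc hz) (hC.fc hz) dAC
  have iBC := fc_inter (hB.fc hz) (hC.fc hz) dBC
  set a := edgeVerts A with ha
  set b := edgeVerts B with hb
  set c := edgeVerts C with hc
  have uAB := Finset.card_union_add_card_inter a b
  have uAC := Finset.card_union_add_card_inter a c
  have uBC := Finset.card_union_add_card_inter b c
  have sAB : (a ∪ b).card ≤ (a ∪ b ∪ c).card := Finset.card_le_card (by grind)
  have sAC : (a ∪ c).card ≤ (a ∪ b ∪ c).card := Finset.card_le_card (by grind)
  have sBC : (b ∪ c).card ≤ (a ∪ b ∪ c).card := Finset.card_le_card (by grind)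
  have eU : a ∪ b = a ∪ b ∪ c := Finset.eq_of_subset_of_card_le (by grind) (by omega)
  have cab : (a ∩ c) ∪ (b ∩ c) = c := by
    ext x
    have : x ∈ c → x ∈ a ∪ b := fun h => by rw [eU]; exact Finset.mem_union_right _ h
    simp only [Finset.mem_union, Finset.mem_inter] at *
    tauto
  have uu := Finset.card_union_add_card_inter (a ∩ c) (b ∩ c)
  rw [cab] at uu
  have e0 : ((a ∩ c) ∩ (b ∩ c)) = ∅ := by
    rw [← Finset.card_eq_zero]; omega
  have e0' : ∀ x, x ∈ a → x ∈ b → x ∈ c → False := by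
    intro x h1 h2 h3
    have : x ∈ ((a ∩ c) ∩ (b ∩ c)) := by simp [h1, h2, h3]
    rw [e0] at this
    simp at this
  obtain ⟨r, r', hr, er⟩ := Finset.card_eq_two.1 (show (a ∩ b).card = 2 by omega)
  obtain ⟨q, q', hq, eq⟩ := Finset.card_eq_two.1 (show (a ∩ c).card = 2 by omega)
  obtain ⟨p, p', hp, ep⟩ := Finset.card_eq_two.1 (show (b ∩ c).card = 2 by omega)
  have r1 : r ∈ a ∩ b := by rw [er]; simp
  have r2 : r' ∈ a ∩ b := by rw [er]; simp
  have q1 : q ∈ a ∩ c := by rw [eq]; simp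
  have q2 : q' ∈ a ∩ c := by rw [eq]; simp
  have p1 : p ∈ b ∩ c := by rw [ep]; simp
  have p2 : p' ∈ b ∩ c := by rw [ep]; simp
  rw [Finset.mem_inter] at r1 r2 q1 q2 p1 p2
  have n1 : ∀ y, y ∈ b ∩ c → ∀ x, x ∈ a ∩ b → x ≠ y := by
    rintro y hy x hx rfl
    rw [Finset.mem_inter] at hx hy
    exact e0' x hx.1 hx.2 hy.2
  have n2 : ∀ y, y ∈ b ∩ c → ∀ x, x ∈ a ∩ c → x ≠ y := by
    rintro y hy x hx rfl
    rw [Finset.mem_inter] at hx hy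
    exact e0' x hx.1 hy.1 hy.2
  have n3 : ∀ y, y ∈ a ∩ c → ∀ x, x ∈ a ∩ b → x ≠ y := by
    rintro y hy x hx rfl
    rw [Finset.mem_inter] at hx hy
    exact e0' x hx.1 hx.2 hy.2
  have nA : [q, q', r, r'].Nodup := by
    simp only [List.nodup_cons, List.mem_cons, List.not_mem_nil, or_false, not_or]
    simp only [Finset.mem_inter] at n3
    exact ⟨⟨hq, (n3 _ q1 _ r1).symm, (n3 _ q1 _ r2).symm⟩, ⟨(n3 _ q2 _ r1).symm, (n3 _ q2 _ r2).symm⟩, hr, not_false, List.nodup_nil⟩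
  have nB : [p, p', r, r'].Nodup := by
    simp only [List.nodup_cons, List.mem_cons, List.not_mem_nil, or_false, not_or]
    simp only [Finset.mem_inter] at n1
    exact ⟨⟨hp, (n1 _ p1 _ r1).symm, (n1 _ p1 _ r2).symm⟩, ⟨(n1 _ p2 _ r1).symm, (n1 _ p2 _ r2).symm⟩, hr, not_false, List.nodup_nil⟩
  have nC : [p, p', q, q'].Nodup := by
    simp only [List.nodup_cons, List.mem_cons, List.not_mem_nil, or_false, not_or]
    simp only [Finset.mem_inter] at n2
    exact ⟨⟨hp, (n2 _ p1 _ q1).symm, (n2 _ p1 _ q2).symm⟩, ⟨(n2 _ p2 _ q1).symm, (n2 _ p2 _ q2).symm⟩, hq, not_false, List.nodup_nil⟩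
  have sw : ∀ {x y u w : V}, [x, y, u, w].Nodup → [u, w, x, y].Nodup := by
    intro x y u w h
    simp only [List.nodup_cons, List.mem_cons, List.not_mem_nil, or_false, not_or] at *
    grind
  have oA : s(q, q') ∈ A ↔ s(r, r') ∈ A :=
    ⟨fc_opp (hA.fc hz) q1.1 q2.1 r1.1 r2.1 nA, fc_opp (hA.fc hz) r1.1 r2.1 q1.1 q2.1 (sw nA)⟩
  have oB : s(p, p') ∈ B ↔ s(r, r') ∈ B :=
    ⟨fc_opp (hB.fc hz) p1.1 p2.1 r1.2 r2.2 nB, fc_opp (hB.fc hz) r1.2 r2.2 p1.1 p2.1 (sw nB)⟩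
  have oC : s(p, p') ∈ C ↔ s(q, q') ∈ C :=
    ⟨fc_opp (hC.fc hz) p1.2 p2.2 q1.2 q2.2 nC, fc_opp (hC.fc hz) q1.2 q2.2 p1.2 p2.2 (sw nC)⟩
  have d1 : s(r, r') ∈ A → s(r, r') ∉ B := fun h => Finset.disjoint_left.1 dAB h
  have d2 : s(q, q') ∈ A → s(q, q') ∉ C := fun h => Finset.disjoint_left.1 dAC h
  have d3 : s(p, p') ∈ B → s(p, p') ∉ C := fun h => Finset.disjoint_left.1 dBC h
  have t1 := six_aux hz hA hB hC nA nB nC q1.1 q2.1 r1.1 r2.1 p1.1 p2.1 r1.2 r2.2 p1.2 p2.2 q1.2 q2.2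
  have t2 := six_aux hz hB hA hC nB nA (sw nC) p1.1 p2.1 r1.2 r2.2 q1.1 q2.1 r1.1 r2.1 q1.2 q2.2
    p1.2 p2.2
  have t3 := six_aux hz hC hA hB nC (sw nA) (sw nB) p1.2 p2.2 q1.2 q2.2 r1.1 r2.1 q1.1 q2.1 r1.2 r2.2
    p1.1 p2.1
  clear_value a b c
  by_cases hA' : s(q, q') ∈ A
  · exact t1 (fun h => d1 (oA.1 hA') (oB.1 h)) (fun h => d2 hA' (oC.1 h))
  · by_cases hB' : s(p, p') ∈ B
    · exact t2 hA' (fun h => d3 hB' (oC.2 h))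
    · exact t3 (fun h => hA' (oA.2 h)) (fun h => hB' (oB.2 h))

/-- Combinatorial core of the (7,4)-configuration. -/
lemma seven_core {A B C E : Finset (Sym2 V)} (hA : IsFourCycle A) (hB : IsFourCycle B)
    (hC : IsFourCycle C) (hE : IsFourCycle E) (dAB : Disjoint A B) (dAC : Disjoint A C)
    (dAE : Disjoint A E) (dBC : Disjoint B C) (dBE : Disjoint B E)
    {U : Finset V} (hU : U.card = 7) (uA : edgeVerts A ⊆ U) (uB : edgeVerts B ⊆ U)
    (uC : edgeVerts C ⊆ U) (uE : edgeVerts E ⊆ U) {x y : V}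
    (xA : x ∈ edgeVerts A) (xB : x ∈ edgeVerts B) (xC : x ∈ edgeVerts C) (xE : x ∉ edgeVerts E)
    (yA : y ∈ edgeVerts A) (yB : y ∈ edgeVerts B) (yE : y ∈ edgeVerts E) (yC : y ∉ edgeVerts C)
    (hxy : s(x, y) ∈ A) :
    (∀ z ∈ edgeVerts A, z ≠ x → z ≠ y → s(x, z) ∉ A → s(x, z) ∈ C) ∧
    (∀ z ∈ edgeVerts A, z ≠ x → z ≠ y → s(y, z) ∉ A → s(y, z) ∈ E) ∧
    (∀ p q, p ∉ edgeVerts A → q ∉ edgeVerts A → s(x, p) ∈ C → s(y, q) ∈ E → p = q) := by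
  have hne := (fc_edge hA hxy).2.2
  have iAB := fc_inter hA hB dAB
  have zB : ∀ z ∈ edgeVerts A, z ≠ x → z ≠ y → z ∉ edgeVerts B := by
    intro z hz h1 h2 h3
    have : ({x, y, z} : Finset V) ⊆ edgeVerts A ∩ edgeVerts B := by
      intro u hu
      simp only [Finset.mem_insert, Finset.mem_singleton] at hu
      rw [Finset.mem_inter]
      rcases hu with rfl | rfl | rfl <;> tauto
    have h4 := Finset.card_le_card this
    have h5 : ({x, y, z} : Finset V).card = 3 := by
      rw [Finset.card_eq_three]
      exact ⟨x, y, z, hne, h1.symm, h2.symm, rfl⟩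
    omega
  have xyB : s(x, y) ∉ B := fun h => Finset.disjoint_left.1 dAB hxy h
  refine ⟨?_, ?_, ?_⟩
  · intro z hz h1 h2 h3
    rcases fc_sat hA hB hC dAB dAC dBC hU uA uB uC xA xB xC (uA hz) h1 with h | h | h
    · exact absurd h h3
    · exact absurd (fc_edge hB h).2.1 (zB z hz h1 h2)
    · exact h
  · intro z hz h1 h2 h3
    rcases fc_sat hA hB hE dAB dAE dBE hU uA uB uE yA yB yE (uA hz) h2 with h | h | h
    · exact absurd h h3
    · exact absurd (fc_edge hB h).2.1 (zB z hz h1 h2)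
    · exact h
  · intro p q hp hq hxp hyq
    have pC := fc_edge hC hxp
    have qE := fc_edge hE hyq
    have pB : p ∉ edgeVerts B := by
      intro h
      have hpy : y ≠ p := by rintro rfl; exact yC pC.2.1
      rcases fc_three hB yB xB h hne.symm pC.2.2 hpy with h | h
      · rw [Sym2.eq_swap] at h; exact xyB h
      · exact Finset.disjoint_left.1 dBC h hxp
    have qB : q ∉ edgeVerts B := by
      intro h
      have hpy : x ≠ q := by rintro rfl; exact xE qE.2.1
      rcases fc_three hB xB yB h hne qE.2.2 hpy with h | h
      · exact xyB h
      · exact Finset.disjoint_left.1 dBE h hyq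
    by_contra hpq
    have hsub : insert p (insert q (edgeVerts A ∪ edgeVerts B)) ⊆ U := by
      intro u hu
      simp only [Finset.mem_insert, Finset.mem_union] at hu
      rcases hu with rfl | rfl | h | h
      · exact uC pC.2.1
      · exact uE qE.2.1
      · exact uA h
      · exact uB h
    have h1 := Finset.card_le_card hsub
    rw [Finset.card_insert_of_notMem (by simp [hpq, hp, pB]),
      Finset.card_insert_of_notMem (by simp [hq, qB])] at h1
    have h2 := Finset.card_union_add_card_inter (edgeVerts A) (edgeVerts B)
    have := fc_card hA
    have := fc_card hB
    omega

lemma cyc_zero (u : V) : cyc 0 u = cycEdges u (u + 1) (u - 2) (u + 2) := by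
  simp [cyc]

lemma InC.one {n : ℕ} (hz : Good V n) {E : Finset (Sym2 V)} (hE : InC n E) {u w : V}
    (h : s(u, w) ∈ E) (hw : w = u + 1) : E = cycEdges u (u + 1) (u - 2) (u + 2) := by
  obtain ⟨i, hi, t, rfl⟩ := hE
  have h' : s(u, u + ((1 : ℕ) : V)) ∈ cyc i t := by rw [Nat.cast_one, ← hw]; exact h
  rw [mem_cyc_iff hz hi (by omega) (by omega)] at h'
  rcases h' with (⟨h1, h2⟩ | ⟨h1, h2⟩) | (⟨h1, h2⟩ | ⟨h1, h2⟩)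
  · obtain rfl : i = 0 := by omega
    rw [← cyc_zero, h2]
  all_goals omega

lemma InC.two {n : ℕ} (hz : Good V n) {E : Finset (Sym2 V)} (hE : InC n E) {u w : V}
    (h : s(u, w) ∈ E) (hw : w = u + 2) : E = cycEdges u (u + 1) (u - 2) (u + 2) := by
  obtain ⟨i, hi, t, rfl⟩ := hE
  have h' : s(u, u + ((2 : ℕ) : V)) ∈ cyc i t := by rw [Nat.cast_ofNat, ← hw]; exact h
  rw [mem_cyc_iff hz hi (by omega) (by omega)] at h'
  rcases h' with (⟨h1, h2⟩ | ⟨h1, h2⟩) | (⟨h1, h2⟩ | ⟨h1, h2⟩)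
  · omega
  · obtain rfl : i = 0 := by omega
    rw [← cyc_zero, h2]
  all_goals omega

lemma cyc_diag {a b c d : V} (h1 : a ≠ b) (h2 : a ≠ c) (h3 : a ≠ d) (h4 : b ≠ c) (h5 : b ≠ d)
    (h6 : c ≠ d) : s(a, c) ∉ cycEdges a b c d ∧ s(b, d) ∉ cycEdges a b c d := by
  simp only [cycEdges, Finset.mem_insert, Finset.mem_singleton, Sym2.eq_iff]
  have := h1.symm
  have := h2.symm
  have := h3.symm
  have := h4.symm
  have := h5.symm
  have := h6.symm
  constructor <;> tauto

set_option maxHeartbeats 1000000 in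
lemma seven_arith {n : ℕ} (hz : Good V n) {A B C E : Finset (Sym2 V)} (hA : InC n A)
    (hB : InC n B) (hC : InC n C) (hE : InC n E) (dAB : Disjoint A B) (dAC : Disjoint A C)
    (dAE : Disjoint A E) (dBC : Disjoint B C) (dBE : Disjoint B E)
    {U : Finset V} (hU : U.card = 7) (uA : edgeVerts A ⊆ U) (uB : edgeVerts B ⊆ U)
    (uC : edgeVerts C ⊆ U) (uE : edgeVerts E ⊆ U) {x y : V}
    (xA : x ∈ edgeVerts A) (xB : x ∈ edgeVerts B) (xC : x ∈ edgeVerts C) (xE : x ∉ edgeVerts E)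
    (yA : y ∈ edgeVerts A) (yB : y ∈ edgeVerts B) (yE : y ∈ edgeVerts E) (yC : y ∉ edgeVerts C)
    (hxy : s(x, y) ∈ A) (h : y = x + 1 ∨ y = x + 2) : False := by
  obtain ⟨h1, h2, h3⟩ := seven_core (hA.fc hz) (hB.fc hz) (hC.fc hz) (hE.fc hz) dAB dAC dAE dBC dBE
    hU uA uB uC uE xA xB xC xE yA yB yE yC hxy
  have hn := hA.pos
  have z1 : (1 : V) ≠ 0 := by simpa using hz 1 (by omega) (by omega)
  have z2 : (2 : V) ≠ 0 := by simpa using hz 2 (by omega) (by omega)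
  have z3 : (3 : V) ≠ 0 := by simpa using hz 3 (by omega) (by omega)
  have z4 : (4 : V) ≠ 0 := by simpa using hz 4 (by omega) (by omega)
  have z5 : (5 : V) ≠ 0 := by simpa using hz 5 (by omega) (by omega)
  have z6 : (6 : V) ≠ 0 := by simpa using hz 6 (by omega) (by omega)
  have z7 : (7 : V) ≠ 0 := by simpa using hz 7 (by omega) (by omega)
  have f1 : x - 2 ≠ x := fun h => z2 (by linear_combination -h)
  have f2 : x - 2 ≠ x + 1 := fun h => z3 (by linear_combination -h)
  have f3 : x - 2 ≠ x + 2 := fun h => z4 (by linear_combination -h)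
  have f4 : x + 1 ≠ x := fun h => z1 (by linear_combination h)
  have f5 : x + 2 ≠ x := fun h => z2 (by linear_combination h)
  have f6 : x + 1 ≠ x + 2 := fun h => z1 (by linear_combination -h)
  have cd := cyc_diag f4.symm f1.symm f5.symm f2.symm f6 f3
  have eA : A = cycEdges x (x + 1) (x - 2) (x + 2) := by
    rcases h with h | h
    · exact hA.one hz hxy h
    · exact hA.two hz hxy h
  have vA : edgeVerts A = {x, x + 1, x - 2, x + 2} := by rw [eA, edgeVerts_cyc]
  have c1 : s(x, x - 2) ∈ C := by
    apply h1
    · rw [vA]; simp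
    · exact f1
    · rcases h with rfl | rfl
      · exact f2
      · exact f3
    · rw [eA]
      exact cd.1
  have eC := hC.two hz (u := x - 2) (w := x) (by rw [Sym2.eq_swap]; exact c1) (by ring)
  have c2 : s(x, x - 4) ∈ C := by
    have e1 : x - 2 + 2 = x := by ring
    have e2 : x - 2 - 2 = x - 4 := by ring
    rw [eC, e1, e2]
    simp [cycEdges]
  have p1 : x - 4 ∉ edgeVerts A := by
    rw [vA]
    simp only [Finset.mem_insert, Finset.mem_singleton, not_or]
    exact ⟨fun h => z4 (by linear_combination -h), fun h => z5 (by linear_combination -h), fun h => z2 (by linear_combination -h), fun h => z6 (by linear_combination -h)⟩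
  have c3 : s(x + 1, x + 2) ∈ E := by
    have nd : s(x + 1, x + 2) ∉ A := by
      rw [eA]
      exact cd.2
    rcases h with rfl | rfl
    · apply h2 _ _ _ _ nd
      · rw [vA]; simp
      · exact f5
      · exact f6.symm
    · rw [Sym2.eq_swap] at nd ⊢
      apply h2 _ _ _ _ nd
      · rw [vA]; simp
      · exact f4
      · exact f6
  have eE := hE.one hz (u := x + 1) (w := x + 2) c3 (by ring)
  have e1 : x + 1 + 1 = x + 2 := by ring
  have e2 : x + 1 - 2 = x - 1 := by ring
  have e3 : x + 1 + 2 = x + 3 := by ring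
  rw [e1, e2, e3] at eE
  rcases h with rfl | rfl
  · have := h3 (x - 4) (x + 3) p1 (by
      rw [vA]
      simp only [Finset.mem_insert, Finset.mem_singleton, not_or]
      exact ⟨fun h => z3 (by linear_combination h), fun h => z2 (by linear_combination h), fun h => z5 (by linear_combination h), fun h => z1 (by linear_combination h)⟩) c2 (by rw [eE]; simp [cycEdges])
    exact z7 (by linear_combination -this)
  · have := h3 (x - 4) (x - 1) p1 (by
      rw [vA]
      simp only [Finset.mem_insert, Finset.mem_singleton, not_or]
      exact ⟨fun h => z1 (by linear_combination -h), fun h => z2 (by linear_combination -h), fun h => z1 (by linear_combination h), fun h => z3 (by linear_combination -h)⟩) c2 (by rw [eE]; simp [cycEdges])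
    exact z3 (by linear_combination -this)

lemma seven_aux {n : ℕ} (hz : Good V n) {A B C E : Finset (Sym2 V)} (hA : InC n A)
    (hB : InC n B) (hC : InC n C) (hE : InC n E) (dAB : Disjoint A B) (dAC : Disjoint A C)
    (dAE : Disjoint A E) (dBC : Disjoint B C) (dBE : Disjoint B E)
    {U : Finset V} (hU : U.card = 7) (uA : edgeVerts A ⊆ U) (uB : edgeVerts B ⊆ U)
    (uC : edgeVerts C ⊆ U) (uE : edgeVerts E ⊆ U) {x y : V}
    (xA : x ∈ edgeVerts A) (xB : x ∈ edgeVerts B) (xC : x ∈ edgeVerts C) (xE : x ∉ edgeVerts E)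
    (yA : y ∈ edgeVerts A) (yB : y ∈ edgeVerts B) (yE : y ∈ edgeVerts E) (yC : y ∉ edgeVerts C) :
    False := by
  have hne : x ≠ y := by rintro rfl; exact xE yE
  wlog hxy : s(x, y) ∈ A generalizing A B
  · rcases fc_sat (hA.fc hz) (hB.fc hz) (hC.fc hz) dAB dAC dBC hU uA uB uC xA xB xC (uA yA)
      hne.symm with h | h | h
    · exact hxy h
    · exact this hB hA dAB.symm dBC dBE dAC dAE uB uA xB xA yB yA h
    · exact yC (fc_edge (hC.fc hz) h).2.1
  have xyB : s(x, y) ∉ B := fun h => Finset.disjoint_left.1 dAB hxy h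
  have hl : L1 x y ∨ L2 x y := by
    have h4 := fc_card (hB.fc hz)
    have h5 : 1 < (((edgeVerts B).erase x).erase y).card := by
      rw [Finset.card_erase_of_mem (Finset.mem_erase.2 ⟨hne.symm, yB⟩),
        Finset.card_erase_of_mem xB]
      omega
    obtain ⟨u, hu, w, hw, huw⟩ := Finset.one_lt_card.1 h5
    simp only [Finset.mem_erase] at hu hw
    have := hB.diag xB yB hu.2.2 hw.2.2 (by
      simp only [List.nodup_cons, List.mem_cons, List.not_mem_nil, or_false, not_or]
      grind) xyB
    tauto
  have hl' : (y = x + 1 ∨ y = x + 2) ∨ (x = y + 1 ∨ x = y + 2) := by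
    rcases hl with (h | h) | (h | h)
    · right; left; linear_combination h
    · left; left; linear_combination h
    · right; right; linear_combination h
    · left; right; linear_combination h
  rcases hl' with h | h
  · exact seven_arith hz hA hB hC hE dAB dAC dAE dBC dBE hU uA uB uC uE xA xB xC xE yA yB yE yC hxy h
  · rw [Sym2.eq_swap] at hxy
    exact seven_arith hz hA hB hE hC dAB dAE dAC dBE dBC hU uA uB uE uC yA yB yE yC xA xB xC xE hxy h

set_option maxHeartbeats 1000000 in
lemma no_seven {n : ℕ} (hz : Good V n) {A B C E : Finset (Sym2 V)} (hA : InC n A)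
    (hB : InC n B) (hC : InC n C) (hE : InC n E) (hAB : A ≠ B) (hAC : A ≠ C) (hAE : A ≠ E)
    (hBC : B ≠ C) (hBE : B ≠ E) (hCE : C ≠ E)
    (hU : (edgeVerts A ∪ edgeVerts B ∪ edgeVerts C ∪ edgeVerts E).card = 7) : False := by
  have cA := fc_card (hA.fc hz)
  have cB := fc_card (hB.fc hz)
  have cC := fc_card (hC.fc hz)
  have cE := fc_card (hE.fc hz)
  have dAB := hA.disj hz hB hAB
  have dAC := hA.disj hz hC hAC
  have dAE := hA.disj hz hE hAE
  have dBC := hB.disj hz hC hBC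
  have dBE := hB.disj hz hE hBE
  have dCE := hC.disj hz hE hCE
  have iAB := fc_inter (hA.fc hz) (hB.fc hz) dAB
  have iAC := fc_inter (hA.fc hz) (hC.fc hz) dAC
  have iAE := fc_inter (hA.fc hz) (hE.fc hz) dAE
  have iBC := fc_inter (hB.fc hz) (hC.fc hz) dBC
  have iBE := fc_inter (hB.fc hz) (hE.fc hz) dBE
  have iCE := fc_inter (hC.fc hz) (hE.fc hz) dCE
  have tABC := no_six hz hA hB hC hAB hAC hBC
  have tABE := no_six hz hA hB hE hAB hAE hBE
  have tACE := no_six hz hA hC hE hAC hAE hCE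
  have tBCE := no_six hz hB hC hE hBC hBE hCE
  obtain ⟨U, hUdef⟩ : ∃ U, U = edgeVerts A ∪ edgeVerts B ∪ edgeVerts C ∪ edgeVerts E := ⟨_, rfl⟩
  rw [← hUdef] at hU
  have uA : edgeVerts A ⊆ U := by rw [hUdef]; grind
  have uB : edgeVerts B ⊆ U := by rw [hUdef]; grind
  have uC : edgeVerts C ⊆ U := by rw [hUdef]; grind
  have uE : edgeVerts E ⊆ U := by rw [hUdef]; grind
  have n4 : ∀ x, x ∈ edgeVerts A → x ∈ edgeVerts B → x ∈ edgeVerts C → x ∉ edgeVerts E := by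
    intro x xA xB xC xE
    obtain ⟨y, -, -, hy, -⟩ := fc_nbr (hE.fc hz) xE
    have := fc_edge (hE.fc hz) hy
    rcases fc_sat (hA.fc hz) (hB.fc hz) (hC.fc hz) dAB dAC dBC hU uA uB uC xA xB xC
      (uE this.2.1) this.2.2.symm with h | h | h
    · exact Finset.disjoint_left.1 dAE h hy
    · exact Finset.disjoint_left.1 dBE h hy
    · exact Finset.disjoint_left.1 dCE h hy
  have full : ∀ P Q R : Finset V, P ⊆ U → Q ⊆ U → R ⊆ U → 7 ≤ (P ∪ Q ∪ R).card →
      ∀ x ∈ U, x ∈ P ∨ x ∈ Q ∨ x ∈ R := by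
    intro P Q R hP hQ hR h x hx
    have := Finset.eq_of_subset_of_card_le
      (Finset.union_subset (Finset.union_subset hP hQ) hR) (by omega)
    rw [← this] at hx
    simpa [or_assoc] using hx
  have fABC := full _ _ _ uA uB uC tABC
  have fABE := full _ _ _ uA uB uE tABE
  have fACE := full _ _ _ uA uC uE tACE
  have fBCE := full _ _ _ uB uC uE tBCE
  have sA := fun x y => seven_aux (U := U) (x := x) (y := y) hz hA hB hC hE dAB dAC dAE dBC dBE hU uA uB uC uE
  have sB := fun x y => seven_aux (U := U) (x := x) (y := y) hz hA hC hB hE dAC dAB dAE dBC.symm dCE hU uA uC uB uE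
  have sC := fun x y => seven_aux (U := U) (x := x) (y := y) hz hB hC hA hE dBC dAB.symm dBE dAC.symm dCE hU uB uC uA uE
  have sD := fun x y => seven_aux (U := U) (x := x) (y := y) hz hA hE hB hC dAE dAB dAC dBE.symm dCE.symm hU uA uE uB uC
  have sF := fun x y => seven_aux (U := U) (x := x) (y := y) hz hB hE hA hC dBE dAB.symm dBC dAE.symm dCE.symm hU uB uE uA uC
  have sG := fun x y => seven_aux (U := U) (x := x) (y := y) hz hC hE hA hB dCE dAC.symm dBC.symm dAE.symm dBE.symm hU uC uE uA uB
  generalize edgeVerts A = a at *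
  generalize edgeVerts B = b at *
  generalize edgeVerts C = c at *
  generalize edgeVerts E = e at *
  -- pass to indicator sums
  have i1 : ∀ {P Q : Finset V}, P ⊆ U → P ∩ Q ⊆ U := fun h => Finset.inter_subset_left.trans h
  have i2 : ∀ {P Q R : Finset V}, P ⊆ U → P ∩ Q ∩ R ⊆ U := fun h => i1 (i1 h)
  have ind : ∀ P ⊆ U, P.card = ∑ x ∈ U, (if x ∈ P then 1 else 0) := by
    intro P hP
    rw [Finset.sum_ite_mem, Finset.inter_eq_right.2 hP, Finset.card_eq_sum_ones]
  have tri : ∀ P Q R : Finset V, P ⊆ U → Q ⊆ U → R ⊆ U → P.card = 4 → Q.card = 4 → R.card = 4 →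
      (P ∩ Q).card ≤ 2 → (P ∩ R).card ≤ 2 → (Q ∩ R).card ≤ 2 → (P ∩ Q ∩ R).card ≤ 1 := by
    intro P Q R hP hQ hR p q r pq pr qr
    have h1 : P.card + Q.card + R.card + (P ∩ Q ∩ R).card ≤
        U.card + (P ∩ Q).card + (P ∩ R).card + (Q ∩ R).card := by
      rw [ind P hP, ind Q hQ, ind R hR, ind (P ∩ Q ∩ R) (i2 hP), ind (P ∩ Q) (i1 hP),
        ind (P ∩ R) (i1 hP), ind (Q ∩ R) (i1 hQ), Finset.card_eq_sum_ones,
        ← Finset.sum_add_distrib, ← Finset.sum_add_distrib, ← Finset.sum_add_distrib,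
        ← Finset.sum_add_distrib, ← Finset.sum_add_distrib, ← Finset.sum_add_distrib]
      apply Finset.sum_le_sum
      intro x _
      simp only [Finset.mem_inter]
      by_cases h1 : x ∈ P <;> by_cases h2 : x ∈ Q <;> by_cases h3 : x ∈ R <;> simp [h1, h2, h3]
    omega
  have m1 := tri a b c uA uB uC cA cB cC iAB iAC iBC
  have m2 := tri a b e uA uB uE cA cB cE iAB iAE iBE
  have m3 := tri a c e uA uC uE cA cC cE iAC iAE iCE
  have m4 := tri b c e uB uC uE cB cC cE iBC iBE iCE
  have tot : a.card + b.card + c.card + e.card = 2 * U.card + (a ∩ b ∩ c).card + (a ∩ b ∩ e).card +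
      (a ∩ c ∩ e).card + (b ∩ c ∩ e).card := by
    rw [ind a uA, ind b uB, ind c uC, ind e uE, ind (a ∩ b ∩ c) (i2 uA),
      ind (a ∩ b ∩ e) (i2 uA), ind (a ∩ c ∩ e) (i2 uA), ind (b ∩ c ∩ e) (i2 uB),
      Finset.card_eq_sum_ones, Finset.mul_sum,
      ← Finset.sum_add_distrib, ← Finset.sum_add_distrib, ← Finset.sum_add_distrib,
      ← Finset.sum_add_distrib, ← Finset.sum_add_distrib, ← Finset.sum_add_distrib,
      ← Finset.sum_add_distrib]
    apply Finset.sum_congr rfl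
    intro x hx
    have k1 := fABC x hx
    have k2 := fABE x hx
    have k3 := fACE x hx
    have k4 := fBCE x hx
    have k5 := n4 x
    simp only [Finset.mem_inter]
    by_cases h1 : x ∈ a <;> by_cases h2 : x ∈ b <;> by_cases h3 : x ∈ c <;> by_cases h4 : x ∈ e <;>
      simp [h1, h2, h3, h4] at k1 k2 k3 k4 k5 ⊢
  have ex : ∀ P Q R : Finset V, (P ∩ Q ∩ R).card ≠ 0 → ∃ x, x ∈ P ∧ x ∈ Q ∧ x ∈ R := by
    intro P Q R h
    obtain ⟨x, hx⟩ := Finset.card_ne_zero.1 h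
    simp only [Finset.mem_inter] at hx
    exact ⟨x, hx.1.1, hx.1.2, hx.2⟩
  have E1 := ex a b c
  have E2 := ex a b e
  have E3 := ex a c e
  have E4 := ex b c e
  have six : ((a ∩ b ∩ c).card ≠ 0 ∧ (a ∩ b ∩ e).card ≠ 0) ∨
      ((a ∩ b ∩ c).card ≠ 0 ∧ (a ∩ c ∩ e).card ≠ 0) ∨
      ((a ∩ b ∩ c).card ≠ 0 ∧ (b ∩ c ∩ e).card ≠ 0) ∨
      ((a ∩ b ∩ e).card ≠ 0 ∧ (a ∩ c ∩ e).card ≠ 0) ∨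
      ((a ∩ b ∩ e).card ≠ 0 ∧ (b ∩ c ∩ e).card ≠ 0) ∨
      ((a ∩ c ∩ e).card ≠ 0 ∧ (b ∩ c ∩ e).card ≠ 0) := by omega
  rcases six with ⟨g1, g2⟩ | ⟨g1, g2⟩ | ⟨g1, g2⟩ | ⟨g1, g2⟩ | ⟨g1, g2⟩ | ⟨g1, g2⟩
  · obtain ⟨x, x1, x2, x3⟩ := E1 g1
    obtain ⟨y, y1, y2, y3⟩ := E2 g2
    exact sA x y x1 x2 x3 (n4 x x1 x2 x3) y1 y2 y3 (fun h => n4 y y1 y2 h y3)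
  · obtain ⟨x, x1, x2, x3⟩ := E1 g1
    obtain ⟨y, y1, y2, y3⟩ := E3 g2
    exact sB x y x1 x3 x2 (n4 x x1 x2 x3) y1 y2 y3 (fun h => n4 y y1 h y2 y3)
  · obtain ⟨x, x1, x2, x3⟩ := E1 g1
    obtain ⟨y, y1, y2, y3⟩ := E4 g2
    exact sC x y x2 x3 x1 (n4 x x1 x2 x3) y1 y2 y3 (fun h => n4 y h y1 y2 y3)
  · obtain ⟨x, x1, x2, x3⟩ := E2 g1
    obtain ⟨y, y1, y2, y3⟩ := E3 g2
    exact sD x y x1 x3 x2 (fun h => n4 x x1 x2 h x3) y1 y3 y2 (fun h => n4 y y1 h y2 y3)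
  · obtain ⟨x, x1, x2, x3⟩ := E2 g1
    obtain ⟨y, y1, y2, y3⟩ := E4 g2
    exact sF x y x2 x3 x1 (fun h => n4 x x1 x2 h x3) y1 y3 y2 (fun h => n4 y h y1 y2 y3)
  · obtain ⟨x, x1, x2, x3⟩ := E3 g1
    obtain ⟨y, y1, y2, y3⟩ := E4 g2
    exact sG x y x2 x3 x1 (fun h => n4 x x1 h x2 x3) y2 y3 y1 (fun h => n4 y h y1 y2 y3)

lemma sufficiency (n : ℕ) [Fintype V] (hz : Good V n)
    (hs : ∀ x : V, ∃ k < 8 * n + 1, x = (k : V)) (h0 : ((8 * n + 1 : ℕ) : V) = 0) :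
    ∃ C : Finset (Finset (Sym2 V)), IsFourCycleSystem C ∧ RSparse 4 C := by
  classical
  refine ⟨Finset.univ.filter (fun E => InC n E), ⟨?_, ?_⟩, ?_⟩
  · intro E hE
    exact ((Finset.mem_filter.1 hE).2).fc hz
  · intro e he
    induction e with
    | _ x y =>
      obtain ⟨E, hE, hm⟩ := InC.ex hs h0 (x := x) (y := y) he
      refine ⟨E, ⟨by simpa using hE, hm⟩, ?_⟩
      rintro F ⟨hF, hm'⟩
      exact ((Finset.mem_filter.1 hF).2).uniq hz hE hm' hm
  · rintro j h2 h4 D hD ⟨hcard, -, -, hU⟩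
    have hD' : ∀ E ∈ D, InC n E := fun E hE => (Finset.mem_filter.1 (hD hE)).2
    have hj : j = 2 ∨ j = 3 ∨ j = 4 := by omega
    rcases hj with rfl | rfl | rfl
    · obtain ⟨A, B, hAB, rfl⟩ := Finset.card_eq_two.1 hcard
      have hA := hD' A (by simp)
      have hB := hD' B (by simp)
      have := fc_inter (hA.fc hz) (hB.fc hz) (hA.disj hz hB hAB)
      have := Finset.card_union_add_card_inter (edgeVerts A) (edgeVerts B)
      have := fc_card (hA.fc hz)
      have := fc_card (hB.fc hz)
      simp only [Finset.sup_insert, Finset.sup_singleton, Finset.sup_eq_union] at hU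
      omega
    · obtain ⟨A, B, C, hAB, hAC, hBC, rfl⟩ := Finset.card_eq_three.1 hcard
      have := no_six hz (hD' A (by simp)) (hD' B (by simp)) (hD' C (by simp)) hAB hAC hBC
      simp only [Finset.sup_insert, Finset.sup_singleton, Finset.sup_eq_union] at hU
      rw [← Finset.union_assoc] at hU
      omega
    · obtain ⟨A, D', hAD, rfl, hc3⟩ := Finset.card_eq_succ.1 hcard
      obtain ⟨B, C, E, hBC, hBE, hCE, rfl⟩ := Finset.card_eq_three.1 hc3
      simp only [Finset.mem_insert, Finset.mem_singleton, not_or] at hAD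
      simp only [Finset.sup_insert, Finset.sup_singleton, Finset.sup_eq_union] at hU
      rw [← Finset.union_assoc, ← Finset.union_assoc] at hU
      exact no_seven hz (hD' A (by simp)) (hD' B (by simp)) (hD' C (by simp)) (hD' E (by simp))
        hAD.1 hAD.2.1 hAD.2.2 hBC hBE hCE hU

end Construction

/-- There exists a 4-sparse 4-cycle system of order `v` iff `v ≡ 1 (mod 8)`. -/
theorem exists_four_sparse_fourCycleSystem_iff (v : ℕ) (hv : 0 < v) :
    (∃ C : Finset (Finset (Sym2 (Fin v))), IsFourCycleSystem C ∧ RSparse 4 C) ↔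
      v % 8 = 1 := by
  constructor
  · rintro ⟨C, hC, -⟩
    exact necessity v hv hC
  · intro h
    obtain ⟨n, rfl⟩ : ∃ n, v = 8 * n + 1 := ⟨v / 8, by omega⟩
    let _ : CommRing (Fin (8 * n + 1)) := inferInstanceAs (CommRing (ZMod (8 * n + 1)))
    refine sufficiency n ?_ ?_ ?_
    · intro k h1 h2 h3
      have : ((k : ℕ) : ZMod (8 * n + 1)) = 0 := h3
      rw [ZMod.natCast_eq_zero_iff] at this
      exact absurd (Nat.le_of_dvd h1 this) (by omega)
    · intro x
      have : x = ((ZMod.val (n := 8 * n + 1) x : ℕ) : ZMod (8 * n + 1)) :=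
        (ZMod.natCast_zmod_val (n := 8 * n + 1) x).symm
      exact ⟨_, ZMod.val_lt (n := 8 * n + 1) x, this⟩
    · exact ZMod.natCast_self (8 * n + 1)
end

section
/- There exists a strictly 4-sparse 4-cycle system of order v if and only if v ≡ 1 (mod 8). -/
open Finset

namespace Sparse

set_option linter.unusedSectionVars false

/-- A 4-cycle written as a tuple of its vertices. -/
abbrev Cy (V : Type) := V × V × V × V

def pts {V : Type} (t : Cy V) : List V := [t.1, t.2.1, t.2.2.1, t.2.2.2]

/-- Oriented edges of a 4-cycle. -/
def dirE {V : Type} (t : Cy V) : List (V × V) :=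
  [(t.1, t.2.1), (t.2.1, t.1), (t.2.1, t.2.2.1), (t.2.2.1, t.2.1),
   (t.2.2.1, t.2.2.2), (t.2.2.2, t.2.2.1), (t.2.2.2, t.1), (t.1, t.2.2.2)]

def cmap {V W : Type} (f : V → W) (t : Cy V) : Cy W := (f t.1, f t.2.1, f t.2.2.1, f t.2.2.2)

/-- number of common vertices -/
def adjc {V : Type} [DecidableEq V] (t s : Cy V) : ℕ := ((pts t).filter (· ∈ pts s)).length

def un4 {V : Type} [DecidableEq V] (t s r q : Cy V) : ℕ :=
  ((pts t ++ pts s ++ pts r ++ pts q).dedup).length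

/-- the diagonals of `t` and `s` are different pairs -/
def NoDD {V : Type} [DecidableEq V] (t s : Cy V) : Prop :=
  ∀ x ∈ pts t, ∀ y ∈ pts t, x ∈ pts s → y ∈ pts s → x ≠ y → (x, y) ∈ dirE t ∨ (x, y) ∈ dirE s

instance {V : Type} [DecidableEq V] (t s : Cy V) : Decidable (NoDD t s) := by
  unfold NoDD; infer_instance

structure Good {V : Type} [DecidableEq V] (E : V → V → Prop) (C : Set (Cy V)) : Prop where
  nodup : ∀ t ∈ C, (pts t).Nodup
  clique : ∀ t ∈ C, ∀ x ∈ pts t, ∀ y ∈ pts t, x ≠ y → E x y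
  cover : ∀ x y, E x y → ∃ t ∈ C, (x, y) ∈ dirE t
  uniq : ∀ t ∈ C, ∀ s ∈ C, ∀ x y, (x, y) ∈ dirE t → (x, y) ∈ dirE s → t = s
  two : ∀ t ∈ C, ∀ s ∈ C, s ≠ t → 2 ≤ adjc t s → adjc t s ≤ 2 ∧ NoDD t s
  three : ∀ t ∈ C, ∀ s ∈ C, ∀ r ∈ C, s ≠ t → r ≠ t → r ≠ s → 2 ≤ adjc t s → 2 ≤ adjc t r →
    2 ≤ adjc s r → ∃ p ∈ pts t, p ∈ pts s ∧ p ∈ pts r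
  four : ∀ t ∈ C, ∀ s ∈ C, ∀ r ∈ C, ∀ q ∈ C, s ≠ t → r ≠ t → r ≠ s → q ≠ t → q ≠ s → q ≠ r →
    2 ≤ adjc t s → 2 ≤ adjc t r → 2 ≤ adjc s r → 2 ≤ adjc t q → 2 ≤ adjc s q → 8 ≤ un4 t s r q

section basic
variable {V W : Type} [DecidableEq V] [DecidableEq W]

lemma pts_cmap (f : V → W) (t : Cy V) : pts (cmap f t) = (pts t).map f := rfl

lemma dirE_cmap (f : V → W) (t : Cy V) :
    dirE (cmap f t) = (dirE t).map (fun e => (f e.1, f e.2)) := rfl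

lemma cmap_injective {f : V → W} (hf : Function.Injective f) : Function.Injective (cmap f) := by
  rintro ⟨a, b, c, d⟩ ⟨a', b', c', d'⟩ h
  simp only [cmap, Prod.mk.injEq] at h
  obtain ⟨h1, h2, h3, h4⟩ := h
  rw [hf h1, hf h2, hf h3, hf h4]

lemma mem_map_inj {f : V → W} (hf : Function.Injective f) (t : Cy V) (x : V) :
    f x ∈ pts (cmap f t) ↔ x ∈ pts t := by
  rw [pts_cmap, List.mem_map_of_injective hf]

lemma mem_dirE_inj {f : V → W} (hf : Function.Injective f) (t : Cy V) (x y : V) :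
    (f x, f y) ∈ dirE (cmap f t) ↔ (x, y) ∈ dirE t := by
  rw [dirE_cmap]
  have : Function.Injective (fun e : V × V => (f e.1, f e.2)) := by
    rintro ⟨a, b⟩ ⟨c, d⟩ h
    simp only [Prod.mk.injEq] at h
    rw [hf h.1, hf h.2]
  exact List.mem_map_of_injective this (a := (x, y))

lemma adjc_cmap {f : V → W} (hf : Function.Injective f) (t s : Cy V) :
    adjc (cmap f t) (cmap f s) = adjc t s := by
  unfold adjc
  rw [pts_cmap f t, List.filter_map, List.length_map]
  congr 1
  apply List.filter_congr
  intro x _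
  simp [mem_map_inj hf]

lemma un4_cmap {f : V → W} (hf : Function.Injective f) (t s r q : Cy V) :
    un4 (cmap f t) (cmap f s) (cmap f r) (cmap f q) = un4 t s r q := by
  unfold un4
  simp only [pts_cmap, ← List.map_append]
  rw [List.dedup_map_of_injective hf, List.length_map]

lemma NoDD_cmap {f : V → W} (hf : Function.Injective f) {t s : Cy V} (h : NoDD t s) :
    NoDD (cmap f t) (cmap f s) := by
  intro x hx y hy
  rw [pts_cmap] at hx hy
  obtain ⟨x, hx0, rfl⟩ := List.mem_map.1 hx
  obtain ⟨y, hy0, rfl⟩ := List.mem_map.1 hy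
  simp only [mem_map_inj hf, mem_dirE_inj hf, hf.ne_iff]
  exact h x hx0 y hy0

lemma mem_of_dirE {t : Cy V} {x y : V} (h : (x, y) ∈ dirE t) : x ∈ pts t ∧ y ∈ pts t := by
  simp only [dirE, pts, List.mem_cons, Prod.mk.injEq, List.not_mem_nil, or_false] at *
  rcases h with h | h | h | h | h | h | h | h <;> simp [h.1, h.2]

lemma ne_of_dirE {t : Cy V} (ht : (pts t).Nodup) {x y : V} (h : (x, y) ∈ dirE t) : x ≠ y := by
  simp only [dirE, pts, List.mem_cons, Prod.mk.injEq, List.not_mem_nil, or_false,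
    List.nodup_cons, not_or] at *
  rcases h with h | h | h | h | h | h | h | h <;> rw [h.1, h.2] <;> tauto

lemma exists_two {t s : Cy V} (ht : (pts t).Nodup) (h : 2 ≤ adjc t s) :
    ∃ x ∈ pts t, ∃ y ∈ pts t, x ≠ y ∧ x ∈ pts s ∧ y ∈ pts s := by
  unfold adjc at h
  have hn := ht.filter (fun x => decide (x ∈ pts s))
  have hm : ∀ x ∈ (pts t).filter (· ∈ pts s), x ∈ pts t ∧ x ∈ pts s := by
    intro x hx; simpa using hx
  generalize (pts t).filter (· ∈ pts s) = l at h hn hm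
  match l, h with
  | x :: y :: l, _ =>
    have h1 := hm x (by simp)
    have h2 := hm y (by simp)
    refine ⟨x, h1.1, y, h2.1, ?_, h1.2, h2.2⟩
    simp at hn; tauto

theorem Good.map {E : V → V → Prop} {C : Set (Cy V)} (h : Good E C) {f : V → W}
    (hf : Function.Injective f) :
    Good (fun u w => ∃ x y, E x y ∧ f x = u ∧ f y = w) (cmap f '' C) where
  nodup := by
    rintro _ ⟨t, ht, rfl⟩
    rw [pts_cmap]; exact (h.nodup t ht).map hf
  clique := by
    rintro _ ⟨t, ht, rfl⟩ x hx y hy hxy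
    rw [pts_cmap] at hx hy
    obtain ⟨x, hx0, rfl⟩ := List.mem_map.1 hx
    obtain ⟨y, hy0, rfl⟩ := List.mem_map.1 hy
    exact ⟨x, y, h.clique t ht x hx0 y hy0 (fun e => hxy (by rw [e])), rfl, rfl⟩
  cover := by
    rintro _ _ ⟨x, y, hE, rfl, rfl⟩
    obtain ⟨t, ht, hd⟩ := h.cover x y hE
    exact ⟨_, ⟨t, ht, rfl⟩, (mem_dirE_inj hf _ _ _).2 hd⟩
  uniq := by
    rintro _ ⟨t, ht, rfl⟩ _ ⟨s, hs, rfl⟩ x y hx hy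
    obtain ⟨x, -, rfl⟩ := List.mem_map.1 (pts_cmap f t ▸ (mem_of_dirE hx).1)
    obtain ⟨y, -, rfl⟩ := List.mem_map.1 (pts_cmap f t ▸ (mem_of_dirE hx).2)
    rw [mem_dirE_inj hf] at hx hy
    rw [h.uniq t ht s hs x y hx hy]
  two := by
    rintro _ ⟨t, ht, rfl⟩ _ ⟨s, hs, rfl⟩
    rw [adjc_cmap hf, (cmap_injective hf).ne_iff]
    intro h1 h2
    have := h.two t ht s hs h1 h2
    exact ⟨this.1, NoDD_cmap hf this.2⟩
  three := by
    rintro _ ⟨t, ht, rfl⟩ _ ⟨s, hs, rfl⟩ _ ⟨r, hr, rfl⟩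
    simp only [adjc_cmap hf, (cmap_injective hf).ne_iff]
    intro h1 h2 h3 h4 h5 h6
    obtain ⟨p, hp, hp1, hp2⟩ := h.three t ht s hs r hr h1 h2 h3 h4 h5 h6
    exact ⟨f p, (mem_map_inj hf _ _).2 hp, (mem_map_inj hf _ _).2 hp1, (mem_map_inj hf _ _).2 hp2⟩
  four := by
    rintro _ ⟨t, ht, rfl⟩ _ ⟨s, hs, rfl⟩ _ ⟨r, hr, rfl⟩ _ ⟨q, hq, rfl⟩
    simp only [adjc_cmap hf, (cmap_injective hf).ne_iff, un4_cmap hf]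
    exact h.four t ht s hs r hr q hq

theorem Good.congr {E E' : V → V → Prop} {C : Set (Cy V)} (h : Good E C)
    (hE : ∀ x y, E x y ↔ E' x y) : Good E' C := by
  have : E = E' := by ext x y; exact hE x y
  exact this ▸ h

theorem Good.glue {ι : Type} {E : ι → V → V → Prop} {C : ι → Set (Cy V)}
    (h : ∀ i, Good (E i) (C i)) (hd : ∀ i j x y, E i x y → E j x y → i = j) :
    Good (fun x y => ∃ i, E i x y) (⋃ i, C i) := by
  have key : ∀ i j t s, t ∈ C i → s ∈ C j → 2 ≤ adjc t s → i = j := by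
    intro i j t s ht hs h2
    obtain ⟨x, hx, y, hy, hxy, hx', hy'⟩ := exists_two ((h i).nodup t ht) h2
    exact hd i j x y ((h i).clique t ht x hx y hy hxy) ((h j).clique s hs x hx' y hy' hxy)
  constructor
  · intro t ht
    obtain ⟨i, ht⟩ := Set.mem_iUnion.1 ht
    exact (h i).nodup t ht
  · intro t ht x hx y hy hxy
    obtain ⟨i, ht⟩ := Set.mem_iUnion.1 ht
    exact ⟨i, (h i).clique t ht x hx y hy hxy⟩
  · rintro x y ⟨i, hE⟩
    obtain ⟨t, ht, hh⟩ := (h i).cover x y hE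
    exact ⟨t, Set.mem_iUnion.2 ⟨i, ht⟩, hh⟩
  · intro t ht s hs x y hx hy
    obtain ⟨i, ht⟩ := Set.mem_iUnion.1 ht
    obtain ⟨j, hs⟩ := Set.mem_iUnion.1 hs
    have hne := ne_of_dirE ((h i).nodup t ht) hx
    have e : i = j := hd i j x y
      ((h i).clique t ht x (mem_of_dirE hx).1 y (mem_of_dirE hx).2 hne)
      ((h j).clique s hs x (mem_of_dirE hy).1 y (mem_of_dirE hy).2 hne)
    subst e
    exact (h i).uniq t ht s hs x y hx hy
  · intro t ht s hs hne h2
    obtain ⟨i, ht⟩ := Set.mem_iUnion.1 ht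
    obtain ⟨j, hs⟩ := Set.mem_iUnion.1 hs
    obtain rfl := key _ _ _ _ ht hs h2
    exact (h i).two t ht s hs hne h2
  · intro t ht s hs r hr h1 h2 h3 h4 h5 h6
    obtain ⟨i, ht⟩ := Set.mem_iUnion.1 ht
    obtain ⟨j, hs⟩ := Set.mem_iUnion.1 hs
    obtain ⟨k, hr⟩ := Set.mem_iUnion.1 hr
    obtain rfl := key _ _ _ _ ht hs h4
    obtain rfl := key _ _ _ _ ht hr h5
    exact (h i).three t ht s hs r hr h1 h2 h3 h4 h5 h6
  · intro t ht s hs r hr q hq h1 h2 h3 h1' h2' h3' h4 h5 h6 h7 h8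
    obtain ⟨i, ht⟩ := Set.mem_iUnion.1 ht
    obtain ⟨j, hs⟩ := Set.mem_iUnion.1 hs
    obtain ⟨k, hr⟩ := Set.mem_iUnion.1 hr
    obtain ⟨l, hq⟩ := Set.mem_iUnion.1 hq
    obtain rfl := key _ _ _ _ ht hs h4
    obtain rfl := key _ _ _ _ ht hr h5
    obtain rfl := key _ _ _ _ ht hq h7
    exact (h i).four t ht s hs r hr q hq h1 h2 h3 h1' h2' h3' h4 h5 h6 h7 h8

def loc4 (t s r : Cy V) (N : List (Cy V)) : Prop :=
  ∀ q ∈ N, 2 ≤ adjc s q → q ≠ s → q ≠ r → 8 ≤ un4 t s r q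

instance (t s r : Cy V) (N : List (Cy V)) : Decidable (loc4 t s r N) := by
  unfold loc4; infer_instance

def loc3 (t s : Cy V) (N : List (Cy V)) : Prop :=
  ∀ r ∈ N, 2 ≤ adjc s r → r ≠ s →
    (∃ p ∈ pts t, p ∈ pts s ∧ p ∈ pts r) ∧ loc4 t s r N

instance (t s : Cy V) (N : List (Cy V)) : Decidable (loc3 t s N) := by
  unfold loc3; infer_instance

def loc (t : Cy V) (N : List (Cy V)) : Prop :=
  ∀ s ∈ N, (adjc t s ≤ 2 ∧ NoDD t s) ∧ loc3 t s N

instance (t : Cy V) (N : List (Cy V)) : Decidable (loc t N) := by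
  unfold loc; infer_instance


lemma NoDD_of_cmap {f : V → W} (hf : Function.Injective f) {t s : Cy V}
    (h : NoDD (cmap f t) (cmap f s)) : NoDD t s := by
  intro x hx y hy hx' hy' hxy
  have := h (f x) ((mem_map_inj hf _ _).2 hx) (f y) ((mem_map_inj hf _ _).2 hy)
    ((mem_map_inj hf _ _).2 hx') ((mem_map_inj hf _ _).2 hy') (hf.ne hxy)
  simpa only [mem_dirE_inj hf] using this

lemma loc_of_cmap {f : V → W} (hf : Function.Injective f) {t : Cy V} {N : List (Cy V)}
    (h : loc (cmap f t) (N.map (cmap f))) : loc t N := by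
  intro s hs
  have h1 := h _ (List.mem_map.2 ⟨s, hs, rfl⟩)
  rw [adjc_cmap hf] at h1
  refine ⟨⟨h1.1.1, NoDD_of_cmap hf h1.1.2⟩, ?_⟩
  intro r hr h2 hrs
  have h3 := h1.2 _ (List.mem_map.2 ⟨r, hr, rfl⟩) (by rwa [adjc_cmap hf])
    ((cmap_injective hf).ne hrs)
  refine ⟨?_, ?_⟩
  · obtain ⟨p, hp, hp1, hp2⟩ := h3.1
    rw [pts_cmap] at hp
    obtain ⟨p, hp0, rfl⟩ := List.mem_map.1 hp
    rw [mem_map_inj hf] at hp1 hp2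
    exact ⟨p, hp0, hp1, hp2⟩
  · intro q hq h4 hqs hqr
    have := h3.2 _ (List.mem_map.2 ⟨q, hq, rfl⟩) (by rwa [adjc_cmap hf])
      ((cmap_injective hf).ne hqs) ((cmap_injective hf).ne hqr)
    rwa [un4_cmap hf] at this

end basic

section cyclic
variable {K G : Type} [DecidableEq K] [DecidableEq G] [AddCommGroup G]

def sh (z : G) (x : K × G) : K × G := (x.1, x.2 + z)

def dd (t : Cy (K × G)) : List (K × K × G) :=
  (dirE t).map (fun e => (e.1.1, e.2.1, e.2.2 - e.1.2))

lemma sh_inj (z : G) : Function.Injective (sh z : K × G → K × G) := by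
  rintro ⟨a, b⟩ ⟨c, d⟩ h
  simpa [sh] using h

lemma sh_sh (z w : G) (t : Cy (K × G)) : cmap (sh z) (cmap (sh w) t) = cmap (sh (w + z)) t := by
  simp [cmap, sh, add_assoc]

lemma sh_zero (t : Cy (K × G)) : cmap (sh 0) t = t := by
  simp [cmap, sh]

theorem cyclic_good {E : K × G → K × G → Prop} (L : List (Cy (K × G)))
    (hE : ∀ z x y, E x y → E (sh z x) (sh z y))
    (h1 : ∀ t ∈ L, (pts t).Nodup ∧ ∀ x ∈ pts t, ∀ y ∈ pts t, x ≠ y → E x y)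
    (h2 : ∀ g h : K, ∀ d : G, E (g, 0) (h, d) → (g, h, d) ∈ L.flatMap dd)
    (h3 : (L.flatMap dd).Nodup)
    (N : Cy (K × G) → List (Cy (K × G)))
    (h4 : ∀ t ∈ L, loc t (N t))
    (h5 : ∀ t ∈ L, ∀ s ∈ L, ∀ z, cmap (sh z) s ≠ t → 2 ≤ adjc t (cmap (sh z) s) →
      cmap (sh z) s ∈ N t) :
    Good E {c | ∃ t ∈ L, ∃ z, c = cmap (sh z) t} := by
  have inv : ∀ s : Cy (K × G), (∃ t ∈ L, ∃ z, s = cmap (sh z) t) → ∀ z,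
      ∃ s' ∈ L, ∃ w, s = cmap (sh z) (cmap (sh w) s') := by
    rintro s ⟨t, ht, z, rfl⟩ w
    exact ⟨t, ht, z - w, by rw [sh_sh]; simp⟩
  constructor
  · rintro _ ⟨t, ht, z, rfl⟩
    rw [pts_cmap]; exact (h1 t ht).1.map (sh_inj z)
  · rintro _ ⟨t, ht, z, rfl⟩ x hx y hy hxy
    rw [pts_cmap] at hx hy
    obtain ⟨x, hx0, rfl⟩ := List.mem_map.1 hx
    obtain ⟨y, hy0, rfl⟩ := List.mem_map.1 hy
    exact hE z x y ((h1 t ht).2 x hx0 y hy0 (fun e => hxy (by rw [e])))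
  · rintro ⟨g, x⟩ ⟨h, y⟩ hxy
    have := hE (-x) _ _ hxy
    simp only [sh, add_neg_cancel] at this
    obtain ⟨t, ht, hm⟩ := List.mem_flatMap.1 (h2 _ _ _ this)
    obtain ⟨⟨⟨g', p⟩, ⟨h', q⟩⟩, he, heq⟩ := List.mem_map.1 hm
    simp only [Prod.mk.injEq] at heq
    obtain ⟨rfl, rfl, heq⟩ := heq
    refine ⟨_, ⟨t, ht, x - p, rfl⟩, ?_⟩
    have := (mem_dirE_inj (sh_inj (x - p)) t _ _).2 he
    have e : q + (x - p) = y := by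
      have : q + (x - p) = (q - p) + x := by abel
      rw [this, heq]; abel
    simpa [sh, e] using this
  · rintro _ ⟨t, ht, z, rfl⟩ _ ⟨s, hs, w, rfl⟩ x y hx hy
    rw [dirE_cmap] at hx hy
    obtain ⟨e, he, hee⟩ := List.mem_map.1 hx
    obtain ⟨f, hf, hff⟩ := List.mem_map.1 hy
    simp only [Prod.mk.injEq] at hee hff
    have hdd : (fun e : (K × G) × (K × G) => (e.1.1, e.2.1, e.2.2 - e.1.2)) e =
        (fun e : (K × G) × (K × G) => (e.1.1, e.2.1, e.2.2 - e.1.2)) f := by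
      have a1 := hee.1.trans hff.1.symm
      have a2 := hee.2.trans hff.2.symm
      simp only [sh, Prod.mk.injEq] at a1 a2
      simp only [Prod.mk.injEq]
      refine ⟨a1.1, a2.1, ?_⟩
      have : e.2.2 - e.1.2 = (e.2.2 + z) - (e.1.2 + z) := by abel
      rw [this, a1.2, a2.2]; abel
    have hts : t = s := by
      by_contra hne
      rw [List.nodup_flatMap] at h3
      have : Std.Symm (fun a b : Cy (K × G) => a ≠ b → List.Disjoint (dd a) (dd b)) :=
        ⟨fun a b hab hba => (hab hba.symm).symm⟩
      have hp : L.Pairwise (fun a b => a ≠ b → List.Disjoint (dd a) (dd b)) :=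
        by refine List.Pairwise.imp ?_ h3.2; intro a b hab _; exact hab
      have := hp.forall_of_forall
        (fun a _ h => absurd rfl h) ht hs hne
      exact this (List.mem_map.2 ⟨e, he, rfl⟩) (List.mem_map.2 ⟨f, hf, hdd.symm⟩)
    subst hts
    have hef : e = f := by
      rw [List.nodup_flatMap] at h3
      exact List.inj_on_of_nodup_map (h3.1 t ht) he hf hdd
    subst hef
    have a1 := hee.1.trans hff.1.symm
    simp only [sh, Prod.mk.injEq] at a1
    rw [add_left_cancel a1.2]
  · rintro _ ⟨t, ht, z, rfl⟩ s hs
    obtain ⟨s, hs0, w, rfl⟩ := inv s hs z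
    simp only [adjc_cmap (sh_inj z), (cmap_injective (sh_inj z)).ne_iff]
    intro hne h
    have := (h4 t ht _ (h5 t ht _ hs0 w hne h)).1
    exact ⟨this.1, NoDD_cmap (sh_inj z) this.2⟩
  · rintro _ ⟨t, ht, z, rfl⟩ s hs r hr
    obtain ⟨s, hs0, w, rfl⟩ := inv s hs z
    obtain ⟨r, hr0, w', rfl⟩ := inv r hr z
    simp only [adjc_cmap (sh_inj z), (cmap_injective (sh_inj z)).ne_iff]
    intro a1 a2 a3 a4 a5 a6
    have := ((h4 t ht _ (h5 t ht _ hs0 w a1 a4)).2 _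
      (h5 t ht _ hr0 w' a2 a5) a6 a3).1
    obtain ⟨p, hp, hp1, hp2⟩ := this
    exact ⟨sh z p, (mem_map_inj (sh_inj z) _ _).2 hp, (mem_map_inj (sh_inj z) _ _).2 hp1,
      (mem_map_inj (sh_inj z) _ _).2 hp2⟩
  · rintro _ ⟨t, ht, z, rfl⟩ s hs r hr q hq
    obtain ⟨s, hs0, w, rfl⟩ := inv s hs z
    obtain ⟨r, hr0, w', rfl⟩ := inv r hr z
    obtain ⟨q, hq0, w'', rfl⟩ := inv q hq z
    simp only [adjc_cmap (sh_inj z), (cmap_injective (sh_inj z)).ne_iff, un4_cmap (sh_inj z)]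
    intro a1 a2 a3 b1 b2 b3 a4 a5 a6 a7 a8
    exact ((h4 t ht _ (h5 t ht _ hs0 w a1 a4)).2 _
      (h5 t ht _ hr0 w' a2 a5) a6 a3).2 _ (h5 t ht _ hq0 w'' b1 a7) a8 b2 b3

end cyclic

section check

/-- the entries of a list that are seen a second time (`m` is the bit mask of the seen ones) -/
def dups : List ℕ → ℕ → List ℕ
  | [], _ => []
  | d :: l, m => bif Nat.testBit m d then d :: dups l m else dups l (m ||| (1 <<< d))

lemma testBit_step (m d e : ℕ) :
    Nat.testBit (m ||| (1 <<< d)) e = (Nat.testBit m e || decide (d = e)) := by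
  rw [Nat.testBit_or, Nat.one_shiftLeft, Nat.testBit_two_pow]

lemma mem_dups_of_mem {d : ℕ} : ∀ (l : List ℕ) (m : ℕ), Nat.testBit m d = true → d ∈ l →
    d ∈ dups l m
  | e :: l, m, hm, hd => by
    unfold dups
    rcases List.mem_cons.1 hd with rfl | hd
    · simp [hm]
    · cases h : Nat.testBit m e
      · simp only [cond_false]
        exact mem_dups_of_mem l _ (by rw [testBit_step, hm]; rfl) hd
      · simp only [cond_true]
        exact List.mem_cons_of_mem _ (mem_dups_of_mem l m hm hd)

lemma mem_dups_of_count {d : ℕ} : ∀ (l : List ℕ) (m : ℕ), 2 ≤ l.count d → d ∈ dups l m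
  | [], m, h => by simp at h
  | e :: l, m, h => by
    unfold dups
    by_cases hed : e = d
    · subst hed
      have h1 : 1 ≤ l.count e := by simpa using h
      have h2 : e ∈ l := List.count_pos_iff.1 h1
      cases h : Nat.testBit m e
      · simp only [cond_false]
        exact mem_dups_of_mem l _ (by rw [testBit_step]; simp) h2
      · simp
    · have h1 : 2 ≤ l.count d := by simpa [List.count_cons, hed] using h
      cases h : Nat.testBit m e
      · simp only [cond_false]
        exact mem_dups_of_count l _ h1
      · simp only [cond_true]
        exact List.mem_cons_of_mem _ (mem_dups_of_count l m h1)

lemma nodup_of_dups {l : List ℕ} (h : dups l 0 = []) : l.Nodup := by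
  rw [List.nodup_iff_count_le_one]
  intro a
  by_contra hc
  have := mem_dups_of_count (d := a) l 0 (by omega)
  rw [h] at this; simp at this

lemma testBit_foldl : ∀ (l : List ℕ) (m c : ℕ),
    Nat.testBit (l.foldl (fun m d => m ||| (1 <<< d)) m) c = true →
      Nat.testBit m c = true ∨ c ∈ l
  | [], m, c, h => Or.inl h
  | d :: l, m, c, h => by
    rcases testBit_foldl l _ c h with h | h
    · rw [testBit_step] at h
      simp only [Bool.or_eq_true, decide_eq_true_eq] at h
      rcases h with h | rfl
      · exact Or.inl h
      · simp
    · simp [h]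

def mask (l : List ℕ) : ℕ := l.foldl (fun m d => m ||| (1 <<< d)) 0

lemma testBit_foldl_mono : ∀ (l : List ℕ) (m c : ℕ), Nat.testBit m c = true ∨ c ∈ l →
    Nat.testBit (l.foldl (fun m d => m ||| (1 <<< d)) m) c = true
  | [], m, c, h => by simpa using h
  | d :: l, m, c, h => by
    apply testBit_foldl_mono l
    rw [testBit_step]
    rcases h with h | h
    · simp [h]
    · rcases List.mem_cons.1 h with rfl | h
      · simp
      · exact Or.inr h

lemma testBit_mask {l : List ℕ} {c : ℕ} (h : c ∈ l) : Nat.testBit (mask l) c = true :=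
  testBit_foldl_mono l 0 c (Or.inr h)

/-- bit mask of all differences of points of `t` -/
def dmk (M : ℕ) (t : Cy ℕ) : ℕ :=
  mask ((pts t).flatMap fun p => ((pts t).filter (fun q => q ≠ p)).map fun q => (q + M - p) % M)

lemma testBit_dmk {M : ℕ} {t : Cy ℕ} {p q : ℕ} (hp : p ∈ pts t) (hq : q ∈ pts t) (h : q ≠ p) :
    Nat.testBit (dmk M t) ((q + M - p) % M) = true := by
  apply testBit_mask
  refine List.mem_flatMap.2 ⟨p, hp, List.mem_map.2 ⟨q, ?_, rfl⟩⟩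
  rw [List.mem_filter]
  exact ⟨hq, by simpa using h⟩

lemma land_ne_zero {a b c : ℕ} (ha : Nat.testBit a c = true) (hb : Nat.testBit b c = true) :
    a &&& b ≠ 0 := by
  intro h
  have : Nat.testBit (a &&& b) c = true := by rw [Nat.testBit_and, ha, hb]; rfl
  rw [h] at this
  simp at this

lemma diff_shift {M a b w : ℕ} (ha : a < M) (hb : b < M) (hw : w < M) :
    ((b + w) % M + M - (a + w) % M) % M = (b + M - a) % M := by
  have h1 : ∀ a < M, (a + w) % M = if a + w < M then a + w else a + w - M := by
    intro a ha
    split_ifs with hc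
    · exact Nat.mod_eq_of_lt hc
    · rw [Nat.mod_eq_sub_mod (by omega), Nat.mod_eq_of_lt (by omega)]
  rw [h1 a ha, h1 b hb]
  split_ifs with c1 c2 c2
  · congr 1; omega
  · have e : b + w + M - (a + w - M) = b + M - a + M := by omega
    rw [e, Nat.add_mod_right]
  · have e : b + M - a = b + w - M + M - (a + w) + M := by omega
    rw [e, Nat.add_mod_right]
  · congr 1; omega

def shl (M : ℕ) (t s : Cy ℕ) : List ℕ :=
  (pts t).flatMap fun p => (pts s).map fun q => (p + M - q) % M

/-- candidates for cycles sharing two points with `t` -/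
def nbs (k M : ℕ) (L : List (Cy ℕ)) (t : Cy ℕ) : List (Cy ℕ) :=
  ((L.filter (fun s => (dmk M t &&& dmk M s) ≠ 0)).flatMap fun s => ((dups (shl M t s) 0).filter (fun d => d % k = 0)).map
    (fun d => cmap (fun q => (q + d) % M) s)).filter (fun s => s ≠ t)

/-- code of the edge difference -/
def ecode (k N : ℕ) (e : ℕ × ℕ) : ℕ :=
  e.1 % k + k * (e.2 % k + k * ((N - e.1 / k + e.2 / k) % N))

def diffs (k N : ℕ) (L : List (Cy ℕ)) : List ℕ := L.flatMap fun t => (dirE t).map (ecode k N)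

def Test (k N : ℕ) (ec : ℕ → ℕ → Bool) (L : List (Cy ℕ)) : Prop :=
  (∀ t ∈ L, (pts t).Nodup ∧ (∀ x ∈ pts t, x < k * N) ∧
    ∀ x ∈ pts t, ∀ y ∈ pts t, x ≠ y → ec x y = true) ∧
  (∀ g < k, ∀ h < k, ∀ d < N, ec g (h + k * d) = true →
    Nat.testBit (mask (diffs k N L)) (g + k * (h + k * d)) = true) ∧
  dups (diffs k N L) 0 = [] ∧
  (∀ t ∈ L, loc t (nbs k (k * N) L t))

instance (k N : ℕ) (ec : ℕ → ℕ → Bool) (L : List (Cy ℕ)) : Decidable (Test k N ec L) := by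
  unfold Test; infer_instance

def enc {k N : ℕ} (x : Fin k × Fin N) : ℕ := x.1.val + k * x.2.val

lemma enc_lt {k N : ℕ} (x : Fin k × Fin N) : enc x < k * N := by
  have h1 := x.1.2
  have h2 : k * (x.2.val + 1) ≤ k * N := Nat.mul_le_mul_left _ x.2.2
  rw [mul_add] at h2
  unfold enc; omega

lemma enc_mod {k N : ℕ} (x : Fin k × Fin N) : enc x % k = x.1.val := by
  unfold enc; rw [Nat.add_mul_mod_self_left, Nat.mod_eq_of_lt x.1.2]

lemma enc_div {k N : ℕ} (x : Fin k × Fin N) : enc x / k = x.2.val := by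
  have := x.1.2
  unfold enc; rw [Nat.add_mul_div_left _ _ (by omega), Nat.div_eq_of_lt x.1.2, zero_add]

lemma enc_inj {k N : ℕ} : Function.Injective (enc : Fin k × Fin N → ℕ) := by
  intro x y h
  have h1 := enc_mod x
  have h2 := enc_div x
  rw [h, enc_mod] at h1
  rw [h, enc_div] at h2
  exact Prod.ext (Fin.ext h1.symm) (Fin.ext h2.symm)

lemma enc_surj {k N p : ℕ} (h : p < k * N) : ∃ x : Fin k × Fin N, enc x = p := by
  have hk : 0 < k := by
    rcases Nat.eq_zero_or_pos k with rfl | h0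
    · simp at h
    · exact h0
  refine ⟨(⟨p % k, Nat.mod_lt _ hk⟩, ⟨p / k, Nat.div_lt_of_lt_mul h⟩), ?_⟩
  exact Nat.mod_add_div p k

lemma enc_sh {k N : ℕ} [NeZero N] (z : Fin N) (x : Fin k × Fin N) :
    enc (sh z x) = (enc x + k * z.val) % (k * N) := by
  have h1 := x.1.2
  rw [Nat.mod_mul]
  have e : enc x + k * z.val = x.1.val + k * (x.2.val + z.val) := by unfold enc; ring
  rw [e, Nat.add_mul_mod_self_left, Nat.mod_eq_of_lt h1, Nat.add_mul_div_left _ _ (by omega),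
    Nat.div_eq_of_lt h1, zero_add]
  simp [enc, sh, Fin.val_add]

lemma cy_surj {k N : ℕ} {t : Cy ℕ} (h : ∀ x ∈ pts t, x < k * N) :
    ∃ t' : Cy (Fin k × Fin N), cmap enc t' = t := by
  obtain ⟨a, b, c, d⟩ := t
  simp only [pts, List.mem_cons, List.not_mem_nil, or_false, forall_eq_or_imp, forall_eq] at h
  obtain ⟨h1, h2, h3, h4⟩ := h
  obtain ⟨a, rfl⟩ := enc_surj h1
  obtain ⟨b, rfl⟩ := enc_surj h2
  obtain ⟨c, rfl⟩ := enc_surj h3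
  obtain ⟨d, rfl⟩ := enc_surj h4
  exact ⟨(a, b, c, d), rfl⟩

lemma list_surj {k N : ℕ} {L : List (Cy ℕ)} (h : ∀ t ∈ L, ∀ x ∈ pts t, x < k * N) :
    ∃ L' : List (Cy (Fin k × Fin N)), L'.map (cmap enc) = L := by
  induction L with
  | nil => exact ⟨[], rfl⟩
  | cons t L ih =>
    obtain ⟨L', hL⟩ := ih (fun s hs => h s (List.mem_cons_of_mem _ hs))
    obtain ⟨t', ht⟩ := cy_surj (h t (by simp))
    exact ⟨t' :: L', by simp [hL, ht]⟩

lemma count_shl {M : ℕ} {t s : Cy ℕ} {d x y : ℕ} (hx : x ∈ pts t) (hy : y ∈ pts t) (hxy : x ≠ y)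
    (h1 : ∃ q ∈ pts s, (x + M - q) % M = d) (h2 : ∃ q ∈ pts s, (y + M - q) % M = d) :
    2 ≤ (shl M t s).count d := by
  obtain ⟨t1, t2, t3, t4⟩ := t
  have hx1 : 1 ≤ ((pts s).map fun q => (x + M - q) % M).count d :=
    List.count_pos_iff.2 (List.mem_map.2 h1)
  have hy1 : 1 ≤ ((pts s).map fun q => (y + M - q) % M).count d :=
    List.count_pos_iff.2 (List.mem_map.2 h2)
  simp only [shl, pts, List.flatMap_cons, List.flatMap_nil, List.count_append, List.mem_cons,
    List.not_mem_nil, or_false] at *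
  rcases hx with rfl | rfl | rfl | rfl <;> rcases hy with rfl | rfl | rfl | rfl <;>
    first
    | exact absurd rfl hxy
    | omega

theorem Test.good {k N : ℕ} [NeZero k] [NeZero N] {ec : ℕ → ℕ → Bool} {L : List (Cy ℕ)}
    (h : Test k N ec L) {E : Fin k × Fin N → Fin k × Fin N → Prop}
    (hE : ∀ z x y, E x y → E (sh z x) (sh z y))
    (hec : ∀ x y, E x y ↔ ec (enc x) (enc y) = true) :
    ∃ C : Set (Cy (Fin k × Fin N)), Good E C := by
  obtain ⟨h1, h2, h3, h4⟩ := h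
  obtain ⟨L', rfl⟩ := list_surj (fun t ht => (h1 t ht).2.1)
  have hM : 0 < k * N := Nat.mul_pos (NeZero.pos k) (NeZero.pos N)
  -- the code of a difference
  let φ : Fin k × Fin k × Fin N → ℕ := fun a => enc (a.1, (⟨enc (a.2.1, a.2.2), enc_lt _⟩ : Fin (k * N)))
  have hφ : Function.Injective φ := by
    rintro ⟨a, b, c⟩ ⟨a', b', c'⟩ hh
    have h1 := enc_inj hh
    simp only [Prod.mk.injEq, Fin.mk.injEq] at h1
    have h2 := enc_inj h1.2
    simp only [Prod.mk.injEq] at h2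
    rw [h1.1, h2.1, h2.2]
  have hdd : (L'.flatMap dd).map φ = diffs k N (L'.map (cmap enc)) := by
    unfold diffs
    rw [List.map_flatMap, List.flatMap_map]
    congr 1
    funext t
    rw [dirE_cmap, List.map_map]
    unfold dd
    rw [List.map_map]
    apply List.map_congr_left
    rintro ⟨x, y⟩ -
    simp only [Function.comp, φ, ecode, enc_mod, enc_div]
    simp [enc, Fin.sub_def]
  have hN : ∀ t ∈ L', ∃ N' : List (Cy (Fin k × Fin N)), N'.map (cmap enc) =
      nbs k (k * N) (L'.map (cmap enc)) (cmap enc t) := by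
    intro t ht
    apply list_surj
    intro s hs x hx
    unfold nbs at hs
    obtain ⟨r, -, hs⟩ := List.mem_flatMap.1 (List.mem_filter.1 hs).1
    obtain ⟨d, -, rfl⟩ := List.mem_map.1 hs
    rw [pts_cmap] at hx
    obtain ⟨q, -, rfl⟩ := List.mem_map.1 hx
    exact Nat.mod_lt _ hM
  choose! F hF using hN
  refine ⟨_, cyclic_good L' hE ?_ ?_ ?_ F ?_ ?_⟩
  · intro t ht
    have := h1 _ (List.mem_map.2 ⟨t, ht, rfl⟩)
    refine ⟨?_, ?_⟩
    · have h := this.1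
      rw [pts_cmap] at h
      exact h.of_map
    · intro x hx y hy hxy
      rw [hec]
      exact this.2.2 _ ((mem_map_inj enc_inj _ _).2 hx) _ ((mem_map_inj enc_inj _ _).2 hy)
        (enc_inj.ne hxy)
  · intro g h d hg
    rw [hec] at hg
    have := h2 g.val g.2 h.val h.2 d.val d.2 (by simpa [enc] using hg)
    rcases testBit_foldl _ _ _ this with h | h
    · simp at h
    · rw [← hdd] at h
      obtain ⟨a, ha, hh⟩ := List.mem_map.1 h
      have : a = (g, _, d) := hφ hh
      rwa [← this]
  · have := nodup_of_dups h3
    rw [← hdd] at this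
    exact this.of_map
  · intro t ht
    apply loc_of_cmap enc_inj
    rw [hF t ht]
    exact h4 _ (List.mem_map.2 ⟨t, ht, rfl⟩)
  · intro t ht s hs z hne h2
    have htn : (pts t).Nodup := by
      have h := (h1 _ (List.mem_map.2 ⟨t, ht, rfl⟩)).1
      rw [pts_cmap] at h
      exact h.of_map
    obtain ⟨x, hx, y, hy, hxy, hxs, hys⟩ := exists_two htn h2
    have hz : k * z.val < k * N := Nat.mul_lt_mul_of_pos_left z.2 (NeZero.pos k)
    have key : ∀ x ∈ pts (cmap (sh z) s), ∃ q ∈ pts (cmap enc s),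
        (enc x + k * N - q) % (k * N) = k * z.val ∧ enc x = (q + k * z.val) % (k * N) ∧
          q < k * N := by
      intro x hx
      rw [pts_cmap] at hx
      obtain ⟨q, hq, rfl⟩ := List.mem_map.1 hx
      refine ⟨enc q, (mem_map_inj enc_inj _ _).2 hq, ?_, enc_sh z q, enc_lt q⟩
      rw [enc_sh]
      have hq := enc_lt q
      generalize enc q = q at *
      generalize k * z.val = w at *
      generalize k * N = M at *
      by_cases hc : q + w < M
      · rw [Nat.mod_eq_of_lt hc]
        have : q + w + M - q = w + M := by omega
        rw [this, Nat.add_mod_right, Nat.mod_eq_of_lt hz]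
      · have e : (q + w) % M = q + w - M := by
          rw [Nat.mod_eq_sub_mod (by omega), Nat.mod_eq_of_lt (by omega)]
        rw [e]
        have : q + w - M + M - q = w := by omega
        rw [this, Nat.mod_eq_of_lt hz]
    have hmem : cmap enc (cmap (sh z) s) ∈ nbs k (k * N) (L'.map (cmap enc)) (cmap enc t) := by
      unfold nbs
      rw [List.mem_filter]
      obtain ⟨a, ha, ha1, ha2, ha3⟩ := key x hxs
      obtain ⟨b, hb, hb1, hb2, hb3⟩ := key y hys
      have hba : b ≠ a := by
        rintro rfl
        exact hxy (enc_inj (ha2.trans hb2.symm))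
      refine ⟨List.mem_flatMap.2 ⟨cmap enc s, ?_, ?_⟩, ?_⟩
      · rw [List.mem_filter]
        refine ⟨List.mem_map.2 ⟨s, hs, rfl⟩, ?_⟩
        have t1 := testBit_dmk (M := k * N) ((mem_map_inj enc_inj _ _).2 hx)
          ((mem_map_inj enc_inj _ _).2 hy) (enc_inj.ne hxy.symm)
        have t2 := testBit_dmk (M := k * N) ha hb hba
        rw [ha2, hb2, diff_shift ha3 hb3 hz] at t1
        simpa using land_ne_zero t1 t2
      · refine List.mem_map.2 ⟨k * z.val, ?_, ?_⟩
        · rw [List.mem_filter]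
          refine ⟨mem_dups_of_count _ _ ?_, by simp⟩
          exact count_shl ((mem_map_inj enc_inj _ _).2 hx) ((mem_map_inj enc_inj _ _).2 hy)
            (enc_inj.ne hxy) ⟨a, ha, ha1⟩ ⟨b, hb, hb1⟩
        · simp only [cmap, enc_sh]
      · simpa using (cmap_injective enc_inj).ne hne
    rw [← hF t ht] at hmem
    obtain ⟨r, hr, hh⟩ := List.mem_map.1 hmem
    rwa [← cmap_injective enc_inj hh]

theorem Test.good1 {N : ℕ} [NeZero N] {L : List (Cy ℕ)} (h : Test 1 N (fun x y => x != y) L) :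
    ∃ C : Set (Cy (Fin 1 × Fin N)), Good (fun x y => x ≠ y) C :=
  h.good (fun z _ _ hxy => (sh_inj z).ne hxy) (fun x y => by simp [enc_inj.eq_iff])

theorem Test.goodK {k N : ℕ} [NeZero k] [NeZero N] {L : List (Cy ℕ)}
    (h : Test k N (fun x y => x % k != y % k) L) :
    ∃ C : Set (Cy (Fin k × Fin N)), Good (fun x y => x.1 ≠ y.1) C :=
  h.good (fun _ _ _ hxy => hxy) (fun x y => by simp [enc_mod, Fin.ext_iff])

end check

section data

theorem good_1 : ∃ C : Set (Cy (Fin 1 × Fin 9)), Good (fun x y => x ≠ y) C :=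
  Test.good1 (L :=
  [(0,1,8,3)]) (by decide +kernel)

theorem good_2 : ∃ C : Set (Cy (Fin 1 × Fin 17)), Good (fun x y => x ≠ y) C :=
  Test.good1 (L :=
  [(0,1,12,4), (0,2,9,12)]) (by decide +kernel)

theorem good_3 : ∃ C : Set (Cy (Fin 1 × Fin 25)), Good (fun x y => x ≠ y) C :=
  Test.good1 (L :=
  [(0,1,18,11), (0,2,8,13), (0,3,13,9)]) (by decide +kernel)

theorem good_7 : ∃ C : Set (Cy (Fin 1 × Fin 57)), Good (fun x y => x ≠ y) C :=
  Test.good1 (L :=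
  [(0,1,49,45), (0,2,18,43), (0,3,29,40), (0,5,11,38), (0,7,51,29), (0,8,23,33), (0,18,54,20)]) (by decide +kernel)

theorem good_8 : ∃ C : Set (Cy (Fin 1 × Fin 65)), Good (fun x y => x ≠ y) C :=
  Test.good1 (L :=
  [(0,1,47,34), (0,2,37,61), (0,3,36,59), (0,5,25,17), (0,7,23,12), (0,9,38,28), (0,14,41,15),
    (0,18,43,22)]) (by decide +kernel)

theorem good_9 : ∃ C : Set (Cy (Fin 1 × Fin 73)), Good (fun x y => x ≠ y) C :=
  Test.good1 (L :=
  [(0,1,24,46), (0,2,70,9), (0,3,29,25), (0,6,50,39), (0,7,26,18), (0,10,41,56), (0,13,58,38),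
    (0,14,57,24), (0,16,53,21)]) (by decide +kernel)

theorem good_10 : ∃ C : Set (Cy (Fin 1 × Fin 81)), Good (fun x y => x ≠ y) C :=
  Test.good1 (L :=
  [(0,1,76,4), (0,2,33,11), (0,3,50,60), (0,5,25,39), (0,7,44,62), (0,8,32,49), (0,12,68,23),
    (0,13,39,66), (0,16,64,35), (0,28,71,30)]) (by decide +kernel)

theorem good_11 : ∃ C : Set (Cy (Fin 1 × Fin 89)), Good (fun x y => x ≠ y) C :=
  Test.good1 (L :=
  [(0,1,70,58), (0,2,52,38), (0,3,85,11), (0,4,66,34), (0,5,47,29), (0,6,74,46), (0,8,73,9),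
    (0,10,50,72), (0,13,79,44), (0,16,72,19), (0,26,67,37)]) (by decide +kernel)

theorem good_12 : ∃ C : Set (Cy (Fin 1 × Fin 97)), Good (fun x y => x ≠ y) C :=
  Test.good1 (L :=
  [(0,1,9,12), (0,2,31,66), (0,4,84,14), (0,5,37,52), (0,6,29,40), (0,7,58,10), (0,9,76,39),
    (0,13,89,33), (0,16,93,34), (0,18,72,53), (0,22,46,71), (0,28,78,42)]) (by decide +kernel)

theorem good_13 : ∃ C : Set (Cy (Fin 1 × Fin 105)), Good (fun x y => x ≠ y) C :=
  Test.good1 (L :=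
  [(0,1,42,34), (0,2,14,36), (0,3,28,76), (0,4,36,27), (0,5,54,99), (0,7,31,74), (0,10,76,59),
    (0,11,102,18), (0,13,55,15), (0,16,35,68), (0,20,97,44), (0,23,90,35), (0,26,84,30)]) (by decide +kernel)

theorem good_14 : ∃ C : Set (Cy (Fin 1 × Fin 113)), Good (fun x y => x ≠ y) C :=
  Test.good1 (L :=
  [(0,1,25,30), (0,2,53,79), (0,3,105,17), (0,4,58,90), (0,6,49,58), (0,7,74,35), (0,8,101,41),
    (0,10,50,99), (0,12,83,56), (0,13,97,69), (0,15,81,16), (0,18,70,91), (0,19,82,37),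
    (0,31,108,33)]) (by decide +kernel)

theorem good_15 : ∃ C : Set (Cy (Fin 1 × Fin 121)), Good (fun x y => x ≠ y) C :=
  Test.good1 (L :=
  [(0,1,91,40), (0,2,44,106), (0,3,27,45), (0,4,25,50), (0,5,85,108), (0,6,80,68), (0,7,50,72),
    (0,8,113,77), (0,9,76,93), (0,10,74,11), (0,14,49,82), (0,19,110,26), (0,20,95,29),
    (0,27,116,56), (0,34,86,48)]) (by decide +kernel)

theorem good_16 : ∃ C : Set (Cy (Fin 1 × Fin 129)), Good (fun x y => x ≠ y) C :=
  Test.good1 (L :=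
  [(0,1,87,31), (0,2,67,28), (0,3,20,108), (0,4,61,32), (0,5,51,119), (0,6,84,18), (0,7,23,38),
    (0,8,55,25), (0,9,83,102), (0,11,127,24), (0,12,91,22), (0,14,58,23), (0,20,79,34),
    (0,33,85,36), (0,37,113,42), (0,40,121,67)]) (by decide +kernel)

theorem good_17 : ∃ C : Set (Cy (Fin 1 × Fin 137)), Good (fun x y => x ≠ y) C :=
  Test.good1 (L :=
  [(0,1,93,52), (0,2,79,93), (0,3,73,11), (0,4,28,10), (0,5,22,80), (0,6,80,27), (0,7,49,20),
    (0,8,41,106), (0,9,35,13), (0,12,42,101), (0,15,31,114), (0,19,56,90), (0,21,77,39),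
    (0,25,68,28), (0,32,100,49), (0,35,126,50), (0,48,130,64)]) (by decide +kernel)

theorem good_18 : ∃ C : Set (Cy (Fin 1 × Fin 145)), Good (fun x y => x ≠ y) C :=
  Test.good1 (L :=
  [(0,1,79,105), (0,2,17,120), (0,3,124,66), (0,4,121,47), (0,5,61,51), (0,6,90,38), (0,7,122,13),
    (0,8,103,60), (0,9,132,73), (0,11,86,31), (0,12,95,46), (0,14,77,110), (0,16,120,20),
    (0,17,71,124), (0,18,37,101), (0,23,134,37), (0,27,133,57), (0,29,97,65)]) (by decide +kernel)

theorem good_19 : ∃ C : Set (Cy (Fin 1 × Fin 153)), Good (fun x y => x ≠ y) C :=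
  Test.good1 (L :=
  [(0,1,120,135), (0,2,95,140), (0,3,124,59), (0,4,83,53), (0,5,96,76), (0,6,112,96),
    (0,7,129,54), (0,8,76,50), (0,9,34,114), (0,10,73,102), (0,11,44,141), (0,14,84,105),
    (0,17,126,71), (0,19,123,87), (0,22,65,111), (0,23,152,37), (0,27,67,125), (0,35,102,61),
    (0,52,141,69)]) (by decide +kernel)

theorem good_43 : ∃ C : Set (Cy (Fin 1 × Fin 345)), Good (fun x y => x ≠ y) C :=
  Test.good1 (L :=
  [(0,1,103,117), (0,2,265,13), (0,3,137,203), (0,4,75,16), (0,5,323,48), (0,6,300,54),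
    (0,7,272,196), (0,8,194,47), (0,9,196,85), (0,10,283,237), (0,11,247,271), (0,12,155,326),
    (0,15,163,137), (0,17,320,98), (0,18,47,188), (0,20,180,212), (0,21,316,180), (0,22,267,94),
    (0,23,68,249), (0,25,164,192), (0,30,146,90), (0,31,132,253), (0,33,139,254), (0,34,322,283),
    (0,35,313,65), (0,36,161,205), (0,37,112,216), (0,38,79,168), (0,40,327,68), (0,43,232,81),
    (0,49,171,64), (0,52,135,195), (0,53,148,267), (0,55,321,169), (0,61,262,63), (0,69,294,132),
    (0,73,331,114), (0,77,238,112), (0,84,263,88), (0,103,324,110), (0,105,305,138),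
    (0,113,340,130), (0,127,309,154)]) (by decide +kernel)

theorem good_K4 : ∃ C : Set (Cy (Fin 4 × Fin 8)), Good (fun x y => x.1 ≠ y.1) C :=
  Test.goodK (L :=
  [(0,5,15,14), (0,1,22,3), (0,13,18,7), (0,17,31,22), (0,25,6,11), (0,21,14,31), (0,29,19,26),
    (0,9,7,10), (0,2,25,27), (0,6,21,15), (0,30,1,19), (0,18,17,23)]) (by decide +kernel)

theorem good_K5 : ∃ C : Set (Cy (Fin 5 × Fin 8)), Good (fun x y => x.1 ≠ y.1) C :=
  Test.goodK (L :=
  [(0,1,24,37), (1,2,25,38), (2,3,26,39), (3,4,27,0), (4,5,28,1), (0,2,28,16), (1,3,29,17),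
    (2,4,30,18), (3,5,31,19), (4,6,32,20), (0,4,38,31), (1,5,39,32), (2,6,0,33), (3,7,1,34),
    (4,8,2,35), (0,8,29,11), (1,9,30,12), (2,10,31,13), (3,11,32,14), (4,12,33,15)]) (by decide +kernel)

theorem good_K6 : ∃ C : Set (Cy (Fin 6 × Fin 8)), Good (fun x y => x.1 ≠ y.1) C :=
  Test.goodK (L :=
  [(0,1,39,8), (1,2,40,9), (2,3,41,10), (3,4,42,11), (4,5,43,12), (5,6,44,13), (0,2,13,16),
    (1,3,14,17), (2,4,15,18), (3,5,16,19), (4,6,17,20), (5,7,18,21), (0,4,33,26), (1,5,34,27),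
    (2,6,35,28), (3,7,36,29), (4,8,37,30), (5,9,38,31), (0,5,25,34), (1,6,26,35), (2,7,27,36),
    (3,8,28,37), (4,9,29,38), (5,10,30,39), (0,13,40,15), (1,14,41,16), (2,15,42,17),
    (3,16,43,18), (4,17,44,19), (5,18,45,20)]) (by decide +kernel)

end data

section construction

/-- existence of a good system on `8 n + 1` points -/
def HasSys (n : ℕ) : Prop := ∃ C : Set (Cy (Fin (8 * n + 1))), Good (fun x y => x ≠ y) C

lemma good_ne_equiv {V W : Type} [DecidableEq V] [DecidableEq W] (e : V ≃ W)
    (h : ∃ C : Set (Cy V), Good (fun x y => x ≠ y) C) :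
    ∃ C : Set (Cy W), Good (fun x y => x ≠ y) C := by
  obtain ⟨C, hC⟩ := h
  refine ⟨_, (hC.map e.injective).congr ?_⟩
  intro x y
  constructor
  · rintro ⟨a, b, hab, rfl, rfl⟩
    exact e.injective.ne hab
  · intro hxy
    exact ⟨e.symm x, e.symm y, e.symm.injective.ne hxy, by simp, by simp⟩

lemma HasSys.to_type {n : ℕ} (h : HasSys n) (V : Type) [DecidableEq V] [Fintype V]
    (hV : Fintype.card V = 8 * n + 1) : ∃ C : Set (Cy V), Good (fun x y => x ≠ y) C :=
  good_ne_equiv (Fintype.equivFinOfCardEq hV).symm h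

lemma HasSys.of_type {n : ℕ} {V : Type} [DecidableEq V] [Fintype V]
    (hV : Fintype.card V = 8 * n + 1) (h : ∃ C : Set (Cy V), Good (fun x y => x ≠ y) C) :
    HasSys n :=
  good_ne_equiv (Fintype.equivFinOfCardEq hV) h

lemma HasSys.of_cyc {n N : ℕ} (hN : N = 8 * n + 1)
    (h : ∃ C : Set (Cy (Fin 1 × Fin N)), Good (fun x y => x ≠ y) C) : HasSys n :=
  HasSys.of_type (by simp [hN]) h

lemma ingr_equiv {Y Z : Type} [DecidableEq Y] [DecidableEq Z] (e : Y ≃ Z)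
    (h : ∃ C : Set (Cy (Y × Fin 8)), Good (fun x y => x.1 ≠ y.1) C) :
    ∃ C : Set (Cy (Z × Fin 8)), Good (fun x y => x.1 ≠ y.1) C := by
  obtain ⟨C, hC⟩ := h
  have hf : Function.Injective (fun p : Y × Fin 8 => (e p.1, p.2)) := by
    rintro ⟨a, b⟩ ⟨c, d⟩ hh
    simpa using hh
  refine ⟨_, (hC.map hf).congr ?_⟩
  intro x y
  constructor
  · rintro ⟨a, b, hab, rfl, rfl⟩
    exact e.injective.ne hab
  · intro hxy
    exact ⟨(e.symm x.1, x.2), (e.symm y.1, y.2), e.symm.injective.ne hxy, by simp, by simp⟩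

lemma ingr (Y : Type) [DecidableEq Y] [Fintype Y] (h1 : 4 ≤ Fintype.card Y)
    (h2 : Fintype.card Y ≤ 6) :
    ∃ C : Set (Cy (Y × Fin 8)), Good (fun x y => x.1 ≠ y.1) C := by
  obtain h | h | h : Fintype.card Y = 4 ∨ Fintype.card Y = 5 ∨ Fintype.card Y = 6 := by omega
  · exact ingr_equiv (Fintype.equivFinOfCardEq h).symm good_K4
  · exact ingr_equiv (Fintype.equivFinOfCardEq h).symm good_K5
  · exact ingr_equiv (Fintype.equivFinOfCardEq h).symm good_K6

/-- the six parallel classes of lines -/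
def lin (m : ℕ) (b : ZMod m × ZMod m) : Fin 6 → ZMod m :=
  ![b.1, b.1 + b.2, b.1 + 2 * b.2, b.1 + 3 * b.2, b.1 + 4 * b.2, b.2]

lemma lin_inj {m : ℕ} (hm : Nat.Coprime m 6) {i j : Fin 6} (hij : i ≠ j)
    {b c : ZMod m × ZMod m} (h1 : lin m b i = lin m c i) (h2 : lin m b j = lin m c j) :
    b = c := by
  have u2 : IsUnit (2 : ZMod m) := by
    have := (ZMod.isUnit_iff_coprime 2 m).2 (Nat.Coprime.coprime_dvd_right (by norm_num : 2 ∣ 6) hm).symm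
    simpa using this
  have u3 : IsUnit (3 : ZMod m) := by
    have := (ZMod.isUnit_iff_coprime 3 m).2 (Nat.Coprime.coprime_dvd_right (by norm_num : 3 ∣ 6) hm).symm
    simpa using this
  have t2 : ∀ z : ZMod m, 2 * z = 0 → z = 0 := fun z hz => (u2.mul_right_eq_zero).1 hz
  have t3 : ∀ z : ZMod m, 3 * z = 0 → z = 0 := fun z hz => (u3.mul_right_eq_zero).1 hz
  have t4 : ∀ z : ZMod m, 4 * z = 0 → z = 0 := fun z hz => t2 _ (t2 _ (by linear_combination hz))
  obtain ⟨x, y⟩ := b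
  obtain ⟨x', y'⟩ := c
  have hy : y - y' = 0 := by
    fin_cases i <;> fin_cases j <;> first
    | exact absurd rfl hij
    | (simp [lin] at h1 h2
       first
       | linear_combination h2
       | linear_combination h1
       | linear_combination h2 - h1
       | linear_combination h1 - h2
       | exact t2 _ (by linear_combination h2 - h1)
       | exact t2 _ (by linear_combination h1 - h2)
       | exact t3 _ (by linear_combination h2 - h1)
       | exact t3 _ (by linear_combination h1 - h2)
       | exact t4 _ (by linear_combination h2 - h1)
       | exact t4 _ (by linear_combination h1 - h2))
  have hy' : y = y' := sub_eq_zero.1 hy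
  subst hy'
  have hx : x = x' := by
    fin_cases i <;> fin_cases j <;> first
    | exact absurd rfl hij
    | (simp [lin] at h1 h2
       first
       | exact h1
       | exact h2)
  rw [hx]

lemma lin_surj {m : ℕ} [NeZero m] (hm : Nat.Coprime m 6) {i j : Fin 6} (hij : i ≠ j)
    (x y : ZMod m) : ∃ b, lin m b i = x ∧ lin m b j = y := by
  have hinj : Function.Injective (fun b : ZMod m × ZMod m => (lin m b i, lin m b j)) := by
    intro b c h
    simp only [Prod.mk.injEq] at h
    exact lin_inj hm hij h.1 h.2
  obtain ⟨b, hb⟩ := Finite.surjective_of_injective hinj (x, y)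
  simp only [Prod.mk.injEq] at hb
  exact ⟨b, hb⟩

theorem HasSys.td {m u w : ℕ} (hm0 : 0 < m) (hm : Nat.Coprime m 6) (hu : u ≤ m) (hw : w ≤ m)
    (pm : HasSys m) (pu : HasSys u) (pw : HasSys w) : HasSys (4 * m + u + w) := by
  have : NeZero m := ⟨by omega⟩
  let sz : Fin 6 → ℕ := ![m, m, m, m, u, w]
  have hsz : ∀ i, sz i ≤ m := by
    intro i; fin_cases i <;> simp [sz, hu, hw]
  have hsz4 : ∀ i : Fin 4, sz (Fin.castLE (by norm_num) i) = m := by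
    intro i; fin_cases i <;> rfl
  have psz : ∀ i, HasSys (sz i) := by
    intro i; fin_cases i <;> simp [sz, pm, pu, pw]
  let X := Σ i : Fin 6, Fin (sz i)
  let inc : X → ZMod m × ZMod m → Prop := fun x b => ((x.2.val : ℕ) : ZMod m) = lin m b x.1
  have incj : ∀ x y : X, ∀ b, inc x b → inc y b → x.1 = y.1 → x = y := by
    rintro ⟨i, x⟩ ⟨j, y⟩ b hx hy hij
    simp only at hij
    subst hij
    have h : ((x.val : ℕ) : ZMod m) = ((y.val : ℕ) : ZMod m) := hx.trans hy.symm
    rw [ZMod.natCast_eq_natCast_iff'] at h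
    rw [Nat.mod_eq_of_lt (lt_of_lt_of_le x.2 (hsz i)),
      Nat.mod_eq_of_lt (lt_of_lt_of_le y.2 (hsz i))] at h
    rw [Fin.ext h]
  let V := Option (X × Fin 8)
  have hcard : Fintype.card V = 8 * (4 * m + u + w) + 1 := by
    simp only [V, X, Fintype.card_option, Fintype.card_prod, Fintype.card_sigma, Fintype.card_fin,
      Fin.sum_univ_six]
    simp [sz]; ring
  refine HasSys.of_type hcard ?_
  let E : (Fin 6 ⊕ (ZMod m × ZMod m)) → V → V → Prop := fun c a b =>
    match c with
    | Sum.inl i => a ≠ b ∧ (∀ p, a = some p → p.1.1 = i) ∧ (∀ p, b = some p → p.1.1 = i)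
    | Sum.inr l => ∃ p q, a = some p ∧ b = some q ∧ inc p.1 l ∧ inc q.1 l ∧ p.1 ≠ q.1
  have hgood : ∀ c, ∃ C : Set (Cy V), Good (E c) C := by
    rintro (i | b)
    · obtain ⟨C, hC⟩ := (psz i).to_type (Option (Fin (sz i) × Fin 8)) (by simp; ring)
      let f : Fin (sz i) × Fin 8 → X × Fin 8 := fun a => (⟨i, a.1⟩, a.2)
      have hf : Function.Injective f := by
        rintro ⟨a, b⟩ ⟨c, d⟩ h
        have h1 : (⟨i, a⟩ : Σ i : Fin 6, Fin (sz i)) = ⟨i, c⟩ := congrArg Prod.fst h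
        have h2 : b = d := congrArg Prod.snd h
        rw [Sigma.mk.injEq] at h1
        rw [eq_of_heq h1.2, h2]
      refine ⟨_, (hC.map (Option.map_injective hf)).congr ?_⟩
      intro x y
      have sur : ∀ x : V, (∀ p, x = some p → p.1.1 = i) → ∃ a, Option.map f a = x := by
        rintro (_ | ⟨⟨j, a⟩, z⟩) h
        · exact ⟨none, rfl⟩
        · have : j = i := h _ rfl
          subst this
          exact ⟨some (a, z), rfl⟩
      constructor
      · rintro ⟨a, b, hab, rfl, rfl⟩
        refine ⟨(Option.map_injective hf).ne hab, ?_, ?_⟩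
        · intro p hp
          obtain ⟨q, -, rfl⟩ := Option.map_eq_some_iff.1 hp
          rfl
        · intro p hp
          obtain ⟨q, -, rfl⟩ := Option.map_eq_some_iff.1 hp
          rfl
      · rintro ⟨hxy, h1, h2⟩
        obtain ⟨a, rfl⟩ := sur x h1
        obtain ⟨b, rfl⟩ := sur y h2
        exact ⟨a, b, fun e => hxy (by rw [e]), rfl, rfl⟩
    · classical
      let Y := {x : X // inc x b}
      have hc6 : Fintype.card Y ≤ 6 := by
        have : Function.Injective (fun y : Y => y.1.1) := by
          rintro ⟨x, hx⟩ ⟨y, hy⟩ h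
          exact Subtype.ext (incj x y b hx hy h)
        simpa using Fintype.card_le_of_injective _ this
      have hc4 : 4 ≤ Fintype.card Y := by
        let g : Fin 4 → Y := fun i => ⟨⟨Fin.castLE (by norm_num) i,
          ⟨(lin m b (Fin.castLE (by norm_num) i)).val, by rw [hsz4]; exact ZMod.val_lt _⟩⟩, by
            simp [inc]⟩
        have : Function.Injective g := by
          intro i j h
          have h1 : (g i).1.1 = (g j).1.1 := by rw [h]
          exact Fin.castLE_injective (by norm_num : 4 ≤ 6) h1
        simpa using Fintype.card_le_of_injective _ this
      obtain ⟨C, hC⟩ := ingr Y hc4 hc6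
      have hf : Function.Injective (fun a : Y × Fin 8 => (some (a.1.1, a.2) : V)) := by
        rintro ⟨a, z⟩ ⟨c, w⟩ h
        have h1 := Option.some.inj h
        have h2 : a.1 = c.1 := congrArg Prod.fst h1
        have h3 : z = w := congrArg Prod.snd h1
        rw [Subtype.ext h2, h3]
      refine ⟨_, (hC.map hf).congr ?_⟩
      intro x y
      constructor
      · rintro ⟨p, q, hpq, rfl, rfl⟩
        exact ⟨_, _, rfl, rfl, p.1.2, q.1.2, fun h => hpq (Subtype.ext h)⟩
      · rintro ⟨p, q, rfl, rfl, hp, hq, hpq⟩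
        exact ⟨(⟨p.1, hp⟩, p.2), (⟨q.1, hq⟩, q.2), fun h => hpq (congrArg Subtype.val h), rfl, rfl⟩
  choose C hC using hgood
  refine ⟨_, (Good.glue hC ?_).congr ?_⟩
  · rintro (i | b) (j | c) x y h1 h2
    · obtain ⟨hxy, h3, h4⟩ := h1
      obtain ⟨-, h5, h6⟩ := h2
      rcases x with _ | p
      · rcases y with _ | q
        · exact absurd rfl hxy
        · rw [← h4 q rfl, ← h6 q rfl]
      · rw [← h3 p rfl, ← h5 p rfl]
    · obtain ⟨hxy, h3, h4⟩ := h1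
      obtain ⟨p, q, rfl, rfl, hp, hq, hpq⟩ := h2
      exact absurd (incj _ _ _ hp hq ((h3 p rfl).trans (h4 q rfl).symm)) hpq
    · obtain ⟨hxy, h3, h4⟩ := h2
      obtain ⟨p, q, rfl, rfl, hp, hq, hpq⟩ := h1
      exact absurd (incj _ _ _ hp hq ((h3 p rfl).trans (h4 q rfl).symm)) hpq
    · obtain ⟨p, q, rfl, rfl, hp, hq, hpq⟩ := h1
      obtain ⟨p', q', hpp, hqq, hp', hq', -⟩ := h2
      obtain rfl := Option.some.inj hpp
      obtain rfl := Option.some.inj hqq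
      have hne : p.1.1 ≠ q.1.1 := fun h => hpq (incj _ _ _ hp hq h)
      rw [lin_inj hm hne (hp.symm.trans hp') (hq.symm.trans hq')]
  · intro x y
    constructor
    · rintro ⟨i | b, h⟩
      · exact h.1
      · obtain ⟨p, q, rfl, rfl, -, -, hpq⟩ := h
        intro h
        exact hpq (congrArg Prod.fst (Option.some.inj h))
    · intro hxy
      rcases x with _ | p
      · rcases y with _ | q
        · exact absurd rfl hxy
        · refine ⟨Sum.inl q.1.1, hxy, ?_, ?_⟩
          · intro p hp; simp at hp
          · intro p hp; rw [Option.some.inj hp]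
      · rcases y with _ | q
        · refine ⟨Sum.inl p.1.1, hxy, ?_, ?_⟩
          · intro q hq; rw [Option.some.inj hq]
          · intro q hq; simp at hq
        · by_cases hpq : p.1.1 = q.1.1
          · refine ⟨Sum.inl p.1.1, hxy, ?_, ?_⟩
            · intro q hq; rw [Option.some.inj hq]
            · intro r hr; rw [← Option.some.inj hr, hpq]
          · obtain ⟨b, hb1, hb2⟩ := lin_surj hm hpq ((p.1.2.val : ℕ) : ZMod m)
              ((q.1.2.val : ℕ) : ZMod m)
            exact ⟨Sum.inr b, p, q, rfl, rfl, hb1.symm, hb2.symm, fun h => hpq (by rw [h])⟩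

lemma coprime_six {q r : ℕ} (h : r = 1 ∨ r = 5) : Nat.Coprime (6 * q + r) 6 := by
  rw [Nat.coprime_iff_gcd_eq_one, Nat.gcd_comm, Nat.gcd_mul_left_add_right]
  rcases h with rfl | rfl <;> norm_num

theorem hasSys_all (n : ℕ) : HasSys n := by
  induction n using Nat.strong_induction_on with
  | _ n ih =>
    have h0 : HasSys 0 := by
      refine ⟨∅, ?_, ?_, ?_, ?_, ?_, ?_, ?_⟩ <;> simp
    have step : ∀ q r : ℕ, (r = 1 ∨ r = 5) → 4 * (6 * q + r) ≤ n → n ≤ 6 * (6 * q + r) →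
        HasSys n := by
      intro q r hr h1 h2
      have hm := coprime_six (q := q) hr
      have hm0 : 0 < 6 * q + r := by omega
      generalize 6 * q + r = m at *
      obtain ⟨u, w, hu, hw, hn⟩ : ∃ u w, u ≤ m ∧ w ≤ m ∧ n = 4 * m + u + w := by
        by_cases hc : n - 4 * m ≤ m
        · exact ⟨n - 4 * m, 0, hc, by omega, by omega⟩
        · exact ⟨m, n - 5 * m, le_rfl, by omega, by omega⟩
      rw [hn]
      exact HasSys.td hm0 hm hu hw (ih m (by omega)) (ih u (by omega)) (ih w (by omega))
    by_cases hbig : 20 ≤ n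
    · by_cases h43 : n = 43
      · subst h43; exact .of_cyc (by norm_num) good_43
      by_cases hq : 68 ≤ n
      · have e : n = 24 * ((n - 20) / 24) + 20 + (n - 20) % 24 := by omega
        have h2 : 2 ≤ (n - 20) / 24 := by omega
        have h3 : (n - 20) % 24 < 24 := Nat.mod_lt _ (by norm_num)
        exact step ((n - 20) / 24) 5 (Or.inr rfl) (by omega) (by omega)
      · by_cases h30 : n ≤ 30
        · exact step 0 5 (Or.inr rfl) (by omega) (by omega)
        by_cases h42 : n ≤ 42
        · exact step 1 1 (Or.inl rfl) (by omega) (by omega)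
        by_cases h66 : n ≤ 66
        · exact step 1 5 (Or.inr rfl) (by omega) (by omega)
        · exact step 2 1 (Or.inl rfl) (by omega) (by omega)
    · by_cases h456 : 4 ≤ n ∧ n ≤ 6
      · exact step 0 1 (Or.inl rfl) (by omega) (by omega)
      · obtain h | h | h | h | h | h | h | h | h | h | h | h | h | h | h | h | h : n = 0 ∨ n = 1 ∨
          n = 2 ∨ n = 3 ∨ n = 7 ∨ n = 8 ∨ n = 9 ∨ n = 10 ∨ n = 11 ∨ n = 12 ∨ n = 13 ∨ n = 14 ∨
          n = 15 ∨ n = 16 ∨ n = 17 ∨ n = 18 ∨ n = 19 := by omega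
        · subst h; exact h0
        · subst h; exact .of_cyc (by norm_num) good_1
        · subst h; exact .of_cyc (by norm_num) good_2
        · subst h; exact .of_cyc (by norm_num) good_3
        · subst h; exact .of_cyc (by norm_num) good_7
        · subst h; exact .of_cyc (by norm_num) good_8
        · subst h; exact .of_cyc (by norm_num) good_9
        · subst h; exact .of_cyc (by norm_num) good_10
        · subst h; exact .of_cyc (by norm_num) good_11
        · subst h; exact .of_cyc (by norm_num) good_12
        · subst h; exact .of_cyc (by norm_num) good_13
        · subst h; exact .of_cyc (by norm_num) good_14
        · subst h; exact .of_cyc (by norm_num) good_15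
        · subst h; exact .of_cyc (by norm_num) good_16
        · subst h; exact .of_cyc (by norm_num) good_17
        · subst h; exact .of_cyc (by norm_num) good_18
        · subst h; exact .of_cyc (by norm_num) good_19

end construction

section final
variable {V : Type} [DecidableEq V]

def cyc (t : Cy V) : Finset (Sym2 V) := cycEdges t.1 t.2.1 t.2.2.1 t.2.2.2

def vs (t : Cy V) : Finset V := (pts t).toFinset

lemma mem_cyc {t : Cy V} {x y : V} : s(x, y) ∈ cyc t ↔ (x, y) ∈ dirE t := by
  obtain ⟨a, b, c, d⟩ := t
  simp only [cyc, cycEdges, dirE, Finset.mem_insert, Finset.mem_singleton, Sym2.eq_iff,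
    List.mem_cons, Prod.mk.injEq, List.not_mem_nil, or_false]
  tauto

lemma edgeVerts_cycEdges (a b c d : V) : edgeVerts (cycEdges a b c d) = {a, b, c, d} := by
  ext x
  simp only [edgeVerts, cycEdges, Finset.sup_insert, Finset.sup_singleton, Sym2.lift_mk,
    Finset.sup_eq_union, Finset.mem_union, Finset.mem_insert, Finset.mem_singleton]
  tauto

lemma edgeVerts_cyc (t : Cy V) : edgeVerts (cyc t) = vs t := by
  obtain ⟨a, b, c, d⟩ := t
  rw [cyc, edgeVerts_cycEdges]
  ext x
  simp [vs, pts]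

lemma mem_vs {t : Cy V} {x : V} : x ∈ vs t ↔ x ∈ pts t := List.mem_toFinset

lemma card_vs {t : Cy V} (h : (pts t).Nodup) : (vs t).card = 4 := by
  rw [vs, List.toFinset_card_of_nodup h]; rfl

lemma adjc_eq {t s : Cy V} (h : (pts t).Nodup) : adjc t s = (vs t ∩ vs s).card := by
  have : vs t ∩ vs s = ((pts t).filter (· ∈ pts s)).toFinset := by
    ext x; simp [mem_vs]
  rw [this, List.toFinset_card_of_nodup (h.filter _)]
  rfl

lemma un4_eq (t s r q : Cy V) : un4 t s r q = (vs t ∪ vs s ∪ vs r ∪ vs q).card := by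
  have : vs t ∪ vs s ∪ vs r ∪ vs q = (pts t ++ pts s ++ pts r ++ pts q).toFinset := by
    ext x; simp [mem_vs]
  rw [this, List.card_toFinset]
  rfl

lemma card_ind {A U : Finset V} (h : A ⊆ U) : A.card = ∑ x ∈ U, if x ∈ A then 1 else 0 := by
  rw [Finset.sum_boole, Finset.filter_mem_eq_inter, Finset.inter_eq_right.2 h]
  simp

lemma three_bound (A B D : Finset V) :
    (A ∪ B ∪ D).card + (A ∩ B).card + (A ∩ D).card + (B ∩ D).card =
      A.card + B.card + D.card + (A ∩ B ∩ D).card := by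
  have h1 := Finset.card_union_add_card_inter (A ∪ B) D
  have h2 := Finset.card_union_add_card_inter A B
  have h3 := Finset.card_union_add_card_inter (A ∩ D) (B ∩ D)
  rw [Finset.union_inter_distrib_right] at h1
  have e : A ∩ D ∩ (B ∩ D) = A ∩ B ∩ D := by ext x; simp only [Finset.mem_inter]; tauto
  rw [e] at h3
  omega

lemma four_bound (A B D F : Finset V) :
    2 * (A.card + B.card + D.card + F.card) ≤
      (A ∩ B).card + (A ∩ D).card + (A ∩ F).card + (B ∩ D).card + (B ∩ F).card + (D ∩ F).card
        + 3 * (A ∪ B ∪ D ∪ F).card := by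
  set U := A ∪ B ∪ D ∪ F with hU
  have hA : A ⊆ U := by intro x hx; simp [hU, hx]
  have hB : B ⊆ U := by intro x hx; simp [hU, hx]
  have hD : D ⊆ U := by intro x hx; simp [hU, hx]
  have hF : F ⊆ U := by intro x hx; simp [hU, hx]
  rw [card_ind hA, card_ind hB, card_ind hD, card_ind hF,
    card_ind (Finset.inter_subset_left.trans hA : A ∩ B ⊆ U),
    card_ind (Finset.inter_subset_left.trans hA : A ∩ D ⊆ U),
    card_ind (Finset.inter_subset_left.trans hA : A ∩ F ⊆ U),
    card_ind (Finset.inter_subset_left.trans hB : B ∩ D ⊆ U),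
    card_ind (Finset.inter_subset_left.trans hB : B ∩ F ⊆ U),
    card_ind (Finset.inter_subset_left.trans hD : D ∩ F ⊆ U),
    Finset.card_eq_sum_ones U]
  simp only [← Finset.sum_add_distrib, Finset.mul_sum]
  apply Finset.sum_le_sum
  intro x _
  by_cases h1 : x ∈ A <;> by_cases h2 : x ∈ B <;> by_cases h3 : x ∈ D <;> by_cases h4 : x ∈ F <;>
    simp [h1, h2, h3, h4]

set_option maxHeartbeats 1000000 in
theorem Good.system [Fintype V] {C : Set (Cy V)} (h : Good (fun x y => x ≠ y) C) :
    ∃ F : Finset (Finset (Sym2 V)), IsFourCycleSystem F ∧ StrictlyRSparse 4 F := by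
  classical
  have hinj : ∀ t ∈ C, ∀ s ∈ C, cyc t = cyc s → t = s := by
    intro t ht s hs hts
    have h1 : (t.1, t.2.1) ∈ dirE t := by simp [dirE]
    refine h.uniq t ht s hs _ _ h1 ?_
    rw [← mem_cyc] at h1 ⊢
    rwa [← hts]
  have hmem : ∀ A, A ∈ (Set.toFinite C).toFinset.image cyc ↔ ∃ t ∈ C, cyc t = A := by
    intro A; simp
  have ca : ∀ t ∈ C, (vs t).card = 4 := fun t ht => card_vs (h.nodup t ht)
  have h2 : ∀ t ∈ C, ∀ s ∈ C, t ≠ s → (vs t ∩ vs s).card ≤ 2 := by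
    intro t ht s hs hne
    by_contra hc
    have := (h.two t ht s hs hne.symm (by rw [adjc_eq (h.nodup t ht)]; omega)).1
    rw [adjc_eq (h.nodup t ht)] at this
    omega
  have h3 : ∀ t ∈ C, ∀ s ∈ C, ∀ r ∈ C, t ≠ s → t ≠ r → s ≠ r → 2 ≤ (vs t ∩ vs s).card →
      2 ≤ (vs t ∩ vs r).card → 2 ≤ (vs s ∩ vs r).card → 1 ≤ (vs t ∩ vs s ∩ vs r).card := by
    intro t ht s hs r hr n1 n2 n3 a1 a2 a3
    obtain ⟨p, hp, hp1, hp2⟩ := h.three t ht s hs r hr n1.symm n2.symm n3.symm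
      (by rwa [adjc_eq (h.nodup t ht)]) (by rwa [adjc_eq (h.nodup t ht)])
      (by rwa [adjc_eq (h.nodup s hs)])
    refine Finset.card_pos.2 ⟨p, ?_⟩
    simp [mem_vs, hp, hp1, hp2]
  have h4 : ∀ t ∈ C, ∀ s ∈ C, ∀ r ∈ C, ∀ q ∈ C, t ≠ s → t ≠ r → s ≠ r → t ≠ q → s ≠ q → r ≠ q →
      2 ≤ (vs t ∩ vs s).card → 2 ≤ (vs t ∩ vs r).card → 2 ≤ (vs s ∩ vs r).card →
      2 ≤ (vs t ∩ vs q).card → 2 ≤ (vs s ∩ vs q).card →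
      8 ≤ (vs t ∪ vs s ∪ vs r ∪ vs q).card := by
    intro t ht s hs r hr q hq n1 n2 n3 n4 n5 n6 a1 a2 a3 a4 a5
    rw [← un4_eq]
    exact h.four t ht s hs r hr q hq n1.symm n2.symm n3.symm n4.symm n5.symm n6.symm
      (by rwa [adjc_eq (h.nodup t ht)]) (by rwa [adjc_eq (h.nodup t ht)])
      (by rwa [adjc_eq (h.nodup s hs)]) (by rwa [adjc_eq (h.nodup t ht)])
      (by rwa [adjc_eq (h.nodup s hs)])
  refine ⟨(Set.toFinite C).toFinset.image cyc, ⟨?_, ?_⟩, ?_, ?_⟩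
  · intro A hA
    obtain ⟨t, ht, rfl⟩ := (hmem A).1 hA
    exact ⟨_, _, _, _, h.nodup t ht, rfl⟩
  · intro e he
    induction e with
    | _ x y =>
      have hxy : x ≠ y := by simpa using he
      obtain ⟨t, ht, hd⟩ := h.cover x y hxy
      refine ⟨cyc t, ⟨(hmem _).2 ⟨t, ht, rfl⟩, mem_cyc.2 hd⟩, ?_⟩
      rintro A ⟨hA, hA2⟩
      obtain ⟨s, hs, rfl⟩ := (hmem A).1 hA
      rw [h.uniq t ht s hs x y hd (mem_cyc.1 hA2)]
  · rintro j hj2 hj4 D hD ⟨hcard, -, -, hk⟩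
    obtain rfl | rfl | rfl : j = 2 ∨ j = 3 ∨ j = 4 := by omega
    · obtain ⟨A, B, hAB, rfl⟩ := Finset.card_eq_two.1 hcard
      obtain ⟨t, ht, rfl⟩ := (hmem A).1 (hD (by simp))
      obtain ⟨s, hs, rfl⟩ := (hmem B).1 (hD (by simp))
      have hts : t ≠ s := fun e => hAB (by rw [e])
      simp only [Finset.sup_insert, Finset.sup_singleton, edgeVerts_cyc, Finset.sup_eq_union] at hk
      have := Finset.card_union_add_card_inter (vs t) (vs s)
      have := h2 t ht s hs hts
      rw [ca t ht, ca s hs] at *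
      omega
    · obtain ⟨A, B, F, hAB, hAF, hBF, rfl⟩ := Finset.card_eq_three.1 hcard
      obtain ⟨t, ht, rfl⟩ := (hmem A).1 (hD (by simp))
      obtain ⟨s, hs, rfl⟩ := (hmem B).1 (hD (by simp))
      obtain ⟨r, hr, rfl⟩ := (hmem F).1 (hD (by simp))
      have n1 : t ≠ s := fun e => hAB (by rw [e])
      have n2 : t ≠ r := fun e => hAF (by rw [e])
      have n3 : s ≠ r := fun e => hBF (by rw [e])
      simp only [Finset.sup_insert, Finset.sup_singleton, edgeVerts_cyc, Finset.sup_eq_union,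
        ← Finset.union_assoc] at hk
      have b := three_bound (vs t) (vs s) (vs r)
      have b1 := h2 t ht s hs n1
      have b2 := h2 t ht r hr n2
      have b3 := h2 s hs r hr n3
      have b4 := h3 t ht s hs r hr n1 n2 n3
      rw [ca t ht, ca s hs, ca r hr] at b
      omega
    · obtain ⟨A, D', hAD, rfl, hcard'⟩ := Finset.card_eq_succ.1 hcard
      obtain ⟨B, F, G, hBF, hBG, hFG, rfl⟩ := Finset.card_eq_three.1 hcard'
      obtain ⟨t, ht, rfl⟩ := (hmem A).1 (hD (by simp))
      obtain ⟨s, hs, rfl⟩ := (hmem B).1 (hD (by simp))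
      obtain ⟨r, hr, rfl⟩ := (hmem F).1 (hD (by simp))
      obtain ⟨q, hq, rfl⟩ := (hmem G).1 (hD (by simp))
      simp only [Finset.mem_insert, Finset.mem_singleton, not_or] at hAD
      have n1 : t ≠ s := fun e => hAD.1 (by rw [e])
      have n2 : t ≠ r := fun e => hAD.2.1 (by rw [e])
      have n3 : t ≠ q := fun e => hAD.2.2 (by rw [e])
      have n4 : s ≠ r := fun e => hBF (by rw [e])
      have n5 : s ≠ q := fun e => hBG (by rw [e])
      have n6 : r ≠ q := fun e => hFG (by rw [e])
      simp only [Finset.sup_insert, Finset.sup_singleton, edgeVerts_cyc, Finset.sup_eq_union,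
        ← Finset.union_assoc] at hk
      have b := four_bound (vs t) (vs s) (vs r) (vs q)
      rw [ca t ht, ca s hs, ca r hr, ca q hq] at b
      have b1 := h2 t ht s hs n1
      have b2 := h2 t ht r hr n2
      have b3 := h2 t ht q hq n3
      have b4 := h2 s hs r hr n4
      have b5 := h2 s hs q hq n5
      have b6 := h2 r hr q hq n6
      have c1 := h4 t ht s hs r hr q hq n1 n2 n4 n3 n5 n6
      have c2 := h4 t ht r hr s hs q hq n2 n1 n4.symm n3 n6 n5
      have c3 := h4 t ht q hq s hs r hr n3 n1 n5.symm n2 n6.symm n4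
      have c4 := h4 s hs r hr t ht q hq n4 n1.symm n2.symm n5 n6 n3
      have c5 := h4 s hs q hq t ht r hr n5 n1.symm n3.symm n4 n6.symm n2
      have c6 := h4 r hr q hq t ht s hs n6 n2.symm n3.symm n4.symm n5.symm n1
      have e2 : vs t ∪ vs r ∪ vs s ∪ vs q = vs t ∪ vs s ∪ vs r ∪ vs q := by
        ac_rfl
      have e3 : vs t ∪ vs q ∪ vs s ∪ vs r = vs t ∪ vs s ∪ vs r ∪ vs q := by
        ac_rfl
      have e4 : vs s ∪ vs r ∪ vs t ∪ vs q = vs t ∪ vs s ∪ vs r ∪ vs q := by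
        ac_rfl
      have e5 : vs s ∪ vs q ∪ vs t ∪ vs r = vs t ∪ vs s ∪ vs r ∪ vs q := by
        ac_rfl
      have e6 : vs r ∪ vs q ∪ vs t ∪ vs s = vs t ∪ vs s ∪ vs r ∪ vs q := by
        ac_rfl
      rw [e2] at c2
      rw [e3] at c3
      rw [e4] at c4
      rw [e5] at c5
      rw [e6] at c6
      rw [Finset.inter_comm (vs r) (vs s)] at c2
      rw [Finset.inter_comm (vs q) (vs s), Finset.inter_comm (vs q) (vs r)] at c3
      rw [Finset.inter_comm (vs s) (vs t), Finset.inter_comm (vs r) (vs t)] at c4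
      rw [Finset.inter_comm (vs s) (vs t), Finset.inter_comm (vs q) (vs t),
        Finset.inter_comm (vs q) (vs r)] at c5
      rw [Finset.inter_comm (vs r) (vs t), Finset.inter_comm (vs q) (vs t),
        Finset.inter_comm (vs r) (vs s), Finset.inter_comm (vs q) (vs s)] at c6
      omega
  · rintro A hA B hB ⟨a, b, c, d, e, f, hn, hEA, hEB⟩
    obtain ⟨t, ht, rfl⟩ := (hmem A).1 hA
    obtain ⟨s, hs, rfl⟩ := (hmem B).1 hB
    simp only [List.nodup_cons, List.mem_cons, List.not_mem_nil, or_false, not_or,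
      List.nodup_nil, not_false_eq_true, and_true] at hn
    obtain ⟨⟨hab, hac, had, hae, haf⟩, ⟨hbc, hbd, hbe, hbf⟩, ⟨hcd, hce, hcf⟩, ⟨hde, hdf⟩, hef⟩ := hn
    have hts : s ≠ t := by
      rintro rfl
      rw [hEA] at hEB
      have : s(a, b) ∈ cycEdges a b c d := by simp [cycEdges]
      rw [hEB] at this
      simp [cycEdges, hab, hac, hae, haf, hbc, hbe, hbf, Ne.symm hab] at this
    have hvt := edgeVerts_cyc t
    have hvs := edgeVerts_cyc s
    rw [hEA, edgeVerts_cycEdges] at hvt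
    rw [hEB, edgeVerts_cycEdges] at hvs
    have hat : a ∈ vs t := by simp [← hvt]
    have hct : c ∈ vs t := by simp [← hvt]
    have has : a ∈ vs s := by simp [← hvs]
    have hcs : c ∈ vs s := by simp [← hvs]
    have hadj : 2 ≤ adjc t s := by
      rw [adjc_eq (h.nodup t ht), ← Finset.card_pair hac]
      apply Finset.card_le_card
      intro x hx
      simp only [Finset.mem_insert, Finset.mem_singleton] at hx
      rcases hx with rfl | rfl
      · simp [hat, has]
      · simp [hct, hcs]
    have := (h.two t ht s hs hts hadj).2 a (mem_vs.1 hat) c (mem_vs.1 hct) (mem_vs.1 has)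
      (mem_vs.1 hcs) hac
    rw [← mem_cyc, ← mem_cyc, hEA, hEB] at this
    simp [cycEdges, hac, had, hae, haf, hbc, hcd, hce, hab, Ne.symm hac, Ne.symm hbc, Ne.symm hcd,
      Ne.symm hce, Ne.symm hcf] at this
    try tauto

end final

section necessary
variable {V : Type} [DecidableEq V] [Fintype V]

lemma four_mul_card {C : Finset (Finset (Sym2 V))} (h : IsFourCycleSystem C) :
    4 * C.card = (Fintype.card V).choose 2 := by
  have hU : C.biUnion id = Finset.univ.filter (fun e : Sym2 V => ¬ e.IsDiag) := by
    ext e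
    simp only [Finset.mem_biUnion, id, Finset.mem_filter, Finset.mem_univ, true_and]
    constructor
    · rintro ⟨E, hE, he⟩
      obtain ⟨a, b, c, d, hn, rfl⟩ := h.1 E hE
      simp only [List.nodup_cons, List.mem_cons, List.not_mem_nil, or_false, not_or] at hn
      simp only [cycEdges, Finset.mem_insert, Finset.mem_singleton] at he
      rcases he with rfl | rfl | rfl | rfl <;> simp <;> tauto
    · intro he
      obtain ⟨E, hE, -⟩ := h.2 e he
      exact ⟨E, hE⟩
  have hnd : ∀ E ∈ C, ∀ e ∈ E, ¬ e.IsDiag := by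
    intro E hE e he
    have : e ∈ C.biUnion id := Finset.mem_biUnion.2 ⟨E, hE, he⟩
    rw [hU] at this
    exact (Finset.mem_filter.1 this).2
  have hc := congrArg Finset.card hU
  rw [Finset.card_biUnion] at hc
  · rw [← Fintype.card_subtype, Sym2.card_subtype_not_diag] at hc
    rw [← hc, Finset.sum_const_nat (m := 4), mul_comm]
    intro E hE
    obtain ⟨a, b, c, d, hn, rfl⟩ := h.1 E hE
    simp only [List.nodup_cons, List.mem_cons, List.not_mem_nil, or_false, not_or] at hn
    obtain ⟨⟨hab, hac, had⟩, ⟨hbc, hbd⟩, hcd, -⟩ := hn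
    simp only [id, cycEdges]
    rw [Finset.card_insert_of_notMem, Finset.card_insert_of_notMem, Finset.card_insert_of_notMem,
      Finset.card_singleton]
    all_goals
      simp only [Finset.mem_insert, Finset.mem_singleton, Sym2.eq_iff]
      grind
  · intro E hE F hF hne
    rw [Function.onFun, Finset.disjoint_left]
    intro e he hf
    exact hne ((h.2 e (hnd E hE e he)).unique ⟨hE, he⟩ ⟨hF, hf⟩)

lemma even_card_sub {C : Finset (Finset (Sym2 V))} (h : IsFourCycleSystem C) (x : V) :
    Even (Fintype.card V - 1) := by
  have hU : C.biUnion (fun E => Finset.univ.filter (fun y => s(x, y) ∈ E)) =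
      Finset.univ.erase x := by
    ext y
    simp only [Finset.mem_biUnion, Finset.mem_filter, Finset.mem_univ, true_and, Finset.mem_erase,
      and_true]
    constructor
    · rintro ⟨E, hE, he⟩ rfl
      obtain ⟨a, b, c, d, hn, rfl⟩ := h.1 E hE
      simp only [List.nodup_cons, List.mem_cons, List.not_mem_nil, or_false, not_or] at hn
      simp only [cycEdges, Finset.mem_insert, Finset.mem_singleton, Sym2.eq_iff] at he
      grind
    · intro hy
      obtain ⟨E, hE, -⟩ := h.2 s(x, y) (by simpa using hy.symm)
      exact ⟨E, hE⟩
  have hc := congrArg Finset.card hU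
  rw [Finset.card_erase_of_mem (Finset.mem_univ _), Finset.card_univ, Finset.card_biUnion] at hc
  · rw [← hc]
    apply Finset.even_sum
    intro E hE
    obtain ⟨a, b, c, d, hn, rfl⟩ := h.1 E hE
    simp only [List.nodup_cons, List.mem_cons, List.not_mem_nil, or_false, not_or] at hn
    obtain ⟨⟨hab, hac, had⟩, ⟨hbc, hbd⟩, hcd, -⟩ := hn
    have key : ∀ p q : V, p ≠ q → (∀ y, s(x, y) ∈ cycEdges a b c d ↔ y = p ∨ y = q) →
        Even (Finset.univ.filter (fun y => s(x, y) ∈ cycEdges a b c d)).card := by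
      intro p q hpq hy
      have : Finset.univ.filter (fun y => s(x, y) ∈ cycEdges a b c d) = {p, q} := by
        ext y; simp [hy]
      rw [this, Finset.card_pair hpq]
      exact even_two
    by_cases h1 : x = a
    · refine key b d hbd (fun y => ?_)
      simp only [cycEdges, Finset.mem_insert, Finset.mem_singleton, Sym2.eq_iff]
      grind
    by_cases h2 : x = b
    · refine key a c hac (fun y => ?_)
      simp only [cycEdges, Finset.mem_insert, Finset.mem_singleton, Sym2.eq_iff]
      grind
    by_cases h3 : x = c
    · refine key b d hbd (fun y => ?_)
      simp only [cycEdges, Finset.mem_insert, Finset.mem_singleton, Sym2.eq_iff]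
      grind
    by_cases h4 : x = d
    · refine key a c hac (fun y => ?_)
      simp only [cycEdges, Finset.mem_insert, Finset.mem_singleton, Sym2.eq_iff]
      grind
    have : Finset.univ.filter (fun y => s(x, y) ∈ cycEdges a b c d) = ∅ := by
      ext y
      simp only [cycEdges, Finset.mem_insert, Finset.mem_singleton, Sym2.eq_iff, Finset.mem_filter,
        Finset.mem_univ, true_and, Finset.notMem_empty, iff_false]
      grind
    rw [this]; simp
  · intro E hE F hF hne
    rw [Function.onFun, Finset.disjoint_left]
    intro y he hf
    have he' := (Finset.mem_filter.1 he).2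
    have hf' := (Finset.mem_filter.1 hf).2
    have hy : y ∈ Finset.univ.erase x := by
      rw [← hU]; exact Finset.mem_biUnion.2 ⟨E, hE, he⟩
    have hxy : ¬ (s(x, y)).IsDiag := by
      simpa using (Finset.ne_of_mem_erase hy).symm
    exact hne ((h.2 _ hxy).unique ⟨hE, he'⟩ ⟨hF, hf'⟩)

end necessary

lemma arith {v k : ℕ} (hv : 0 < v) (h1 : 4 * k = v.choose 2) (h2 : Even (v - 1)) : v % 8 = 1 := by
  obtain ⟨w, hw⟩ := h2
  obtain rfl : v = 2 * w + 1 := by omega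
  rw [Nat.choose_two_right] at h1
  have e : (2 * w + 1) * (2 * w + 1 - 1) / 2 = (2 * w + 1) * w := by
    rw [Nat.add_sub_cancel]
    have : (2 * w + 1) * (2 * w) = 2 * ((2 * w + 1) * w) := by ring
    rw [this, Nat.mul_div_cancel_left _ (by norm_num)]
  rw [e] at h1
  have hd := Nat.div_add_mod w 4
  have hr : w % 4 < 4 := Nat.mod_lt _ (by norm_num)
  generalize w / 4 = a at *
  generalize w % 4 = r at *
  subst hd
  interval_cases r <;> ring_nf at h1 ⊢ <;> omega

end Sparse

/-- There exists a strictly 4-sparse 4-cycle system of order `v` iff `v ≡ 1 (mod 8)`. -/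
theorem exists_strictly_four_sparse_fourCycleSystem_iff (v : ℕ) (hv : 0 < v) :
    (∃ C : Finset (Finset (Sym2 (Fin v))), IsFourCycleSystem C ∧ StrictlyRSparse 4 C) ↔
      v % 8 = 1 := by
  constructor
  · rintro ⟨C, hC, -⟩
    have h1 := Sparse.four_mul_card hC
    have h2 := Sparse.even_card_sub hC ⟨0, hv⟩
    rw [Fintype.card_fin] at h1 h2
    exact Sparse.arith hv h1 h2
  · intro h
    obtain ⟨n, rfl⟩ : ∃ n, v = 8 * n + 1 := ⟨v / 8, by omega⟩
    obtain ⟨C, hC⟩ := Sparse.hasSys_all n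
    exact hC.system
end
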